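/- For all integers 1 ≤ p ≤ q, the algebra A(p,q) over an algebraically closed field k is τ-tilting finite. -/

import Mathlib

open MulOpposite CategoryTheory CategoryTheory.Limits

noncomputable section

/-- A submodule `N ≤ M` is superfluous if `N ⊔ K = ⊤` implies `K = ⊤`. -/
def SuperfluousSubmodule {R M : Type} [Ring R] [AddCommGroup M] [Module R M]
    (N : Submodule R M) : Prop :=
  ∀ K : Submodule R M, N ⊔ K = ⊤ → K = ⊤

section TauTilting

variable (k : Type) [Field k]
variable (B : Type) [Ring B] [Algebra k B]

/-- A minimal projective presentation `P1 → P0 → M → 0` of a right `B`-module `M`. -/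
def IsMinimalProjPresentation (M P1 P0 : ModuleCat.{0} Bᵐᵒᵖ)
    (f : P1 →ₗ[Bᵐᵒᵖ] P0) (g : P0 →ₗ[Bᵐᵒᵖ] M) : Prop :=
  Module.Projective Bᵐᵒᵖ P1 ∧ Module.Projective Bᵐᵒᵖ P0 ∧
    Function.Surjective g ∧ LinearMap.range f = LinearMap.ker g ∧
    SuperfluousSubmodule (LinearMap.ker g) ∧ SuperfluousSubmodule (LinearMap.ker f)

/-- Left multiplication by `b` on the left `B`-module `Hom_B(P, B)` of a right module `P`. -/
def leftMulHom {P : Type} [AddCommGroup P] [Module Bᵐᵒᵖ P] (b : B)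
    (h : P →ₗ[Bᵐᵒᵖ] B) : P →ₗ[Bᵐᵒᵖ] B where
  toFun p := b * h p
  map_add' x y := by simp [mul_add]
  map_smul' r p := by
    simp only [map_smul, RingHom.id_apply]
    rw [MulOpposite.smul_eq_mul_unop, MulOpposite.smul_eq_mul_unop, mul_assoc]

/-- `M` is τ-rigid:  `Hom_B(M, τM) = 0`, where `τM = D(Tr M)` is computed from a minimal
projective presentation `P1 --f--> P0 → M → 0`, `Tr M = coker(Hom(P0,B) → Hom(P1,B))`, and
`D = Hom_k(-, k)`.  A right-module map `M → D(Tr M)` is encoded as an additive map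
`β : M →+ Hom_k(Hom_B(P1, B), k)` which is balanced (`β (m·b) = β m (b·-)`) and vanishes on
the image of `Hom(P0,B)`, i.e. descends to the cokernel `Tr M`. -/
def IsTauRigid (M : ModuleCat.{0} Bᵐᵒᵖ) : Prop :=
  ∀ (P1 P0 : ModuleCat.{0} Bᵐᵒᵖ) (f : P1 →ₗ[Bᵐᵒᵖ] P0) (g : P0 →ₗ[Bᵐᵒᵖ] M),
    IsMinimalProjPresentation B M P1 P0 f g →
    ∀ β : M →+ ((P1 →ₗ[Bᵐᵒᵖ] B) →ₗ[k] k),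
      (∀ (m : M) (b : B) (h : P1 →ₗ[Bᵐᵒᵖ] B),
        β (op b • m) h = β m (leftMulHom B b h)) →
      (∀ (m : M) (g0 : P0 →ₗ[Bᵐᵒᵖ] B), β m (g0.comp f) = 0) →
      β = 0

/-- A module is indecomposable if it is nonzero and admits no nontrivial direct sum
decomposition. -/
def IndecomposableMod (M : ModuleCat.{0} Bᵐᵒᵖ) : Prop :=
  Nontrivial M ∧ ∀ (L L' : ModuleCat.{0} Bᵐᵒᵖ),
    Nonempty (M ≃ₗ[Bᵐᵒᵖ] (L × L')) → Subsingleton L ∨ Subsingleton L'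

/-- A module is basic (multiplicity-free) if it has no repeated direct summand. -/
def IsBasicMod (M : ModuleCat.{0} Bᵐᵒᵖ) : Prop :=
  ∀ (L C : ModuleCat.{0} Bᵐᵒᵖ),
    Nonempty (M ≃ₗ[Bᵐᵒᵖ] (L × L × C)) → Subsingleton L

/-- `L` is an indecomposable direct summand of `M`. -/
def IsIndecSummand (L M : ModuleCat.{0} Bᵐᵒᵖ) : Prop :=
  IndecomposableMod B L ∧ ∃ L' : ModuleCat.{0} Bᵐᵒᵖ, Nonempty (M ≃ₗ[Bᵐᵒᵖ] (L × L'))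

/-- The rank of the Grothendieck group `K_0(B)` is `n`, i.e. there are exactly `n`
isomorphism classes of simple right `B`-modules. -/
def RankK0Is (n : ℕ) : Prop :=
  ∃ S : Fin n → ModuleCat.{0} Bᵐᵒᵖ,
    (∀ i, IsSimpleModule Bᵐᵒᵖ (S i)) ∧
    (∀ i j, i ≠ j → IsEmpty ((S i) ≃ₗ[Bᵐᵒᵖ] (S j))) ∧
    (∀ T : ModuleCat.{0} Bᵐᵒᵖ, IsSimpleModule Bᵐᵒᵖ T → ∃ i, Nonempty (T ≃ₗ[Bᵐᵒᵖ] S i))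

/-- The number of isomorphism classes of indecomposable direct summands of `M` is `n`. -/
def NumIndecSummandsIs (M : ModuleCat.{0} Bᵐᵒᵖ) (n : ℕ) : Prop :=
  ∃ N : Fin n → ModuleCat.{0} Bᵐᵒᵖ,
    (∀ i, IsIndecSummand B (N i) M) ∧
    (∀ i j, i ≠ j → IsEmpty ((N i) ≃ₗ[Bᵐᵒᵖ] (N j))) ∧
    (∀ L, IsIndecSummand B L M → ∃ i, Nonempty (L ≃ₗ[Bᵐᵒᵖ] N i))

/-- `M` is a τ-tilting module over `B`: it is a finitely generated τ-rigid module whose number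
of non-isomorphic indecomposable direct summands equals the rank of `K_0(B)`. -/
def IsTauTiltingMod (M : ModuleCat.{0} Bᵐᵒᵖ) : Prop :=
  Module.Finite Bᵐᵒᵖ M ∧ IsTauRigid k B M ∧
    ∃ n : ℕ, NumIndecSummandsIs B M n ∧ RankK0Is B n

end TauTilting

section Support

variable (k : Type) [Field k]
variable (A : Type) [Ring A] [Algebra k A]

/-- The quotient of `A` by the two-sided ideal `AeA` generated by `e`. -/
def IdemQuot (e : A) : Type := ((TwoSidedIdeal.span {e}).ringCon).Quotient

instance (e : A) : Ring (IdemQuot A e) :=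
  inferInstanceAs (Ring ((TwoSidedIdeal.span {e}).ringCon).Quotient)

/-- The quotient map `A → A/AeA`. -/
def IdemQuot.mk (e : A) : A →+* IdemQuot A e := RingCon.mk' _

instance (e : A) : Algebra k (IdemQuot A e) :=
  RingHom.toAlgebra' ((IdemQuot.mk A e).comp (algebraMap k A)) (by
    intro c x
    induction x using Quotient.ind with
    | _ a =>
      show (IdemQuot.mk A e) (algebraMap k A c) * (IdemQuot.mk A e) a
          = (IdemQuot.mk A e) a * (IdemQuot.mk A e) (algebraMap k A c)
      rw [← map_mul, ← map_mul, Algebra.commutes])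

/-- `M` is a support τ-tilting module over `A`: there is an idempotent `e ∈ A` such that `M` is
(the restriction of) a τ-tilting module over `A/AeA`. -/
def IsSupportTauTilting (M : ModuleCat.{0} Aᵐᵒᵖ) : Prop :=
  ∃ e : A, IsIdempotentElem e ∧
    ∃ N : ModuleCat.{0} (IdemQuot A e)ᵐᵒᵖ,
      IsTauTiltingMod k (IdemQuot A e) N ∧
      letI : Module Aᵐᵒᵖ N := Module.compHom N (RingHom.op (IdemQuot.mk A e))
      Nonempty (M ≃ₛₗ[RingHom.id Aᵐᵒᵖ] N)

/-- `A` is τ-tilting finite: it admits only finitely many basic support τ-tilting modules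
up to isomorphism. -/
def TauTiltingFinite : Prop :=
  ∃ (n : ℕ) (R : Fin n → ModuleCat.{0} Aᵐᵒᵖ),
    ∀ M : ModuleCat.{0} Aᵐᵒᵖ, IsSupportTauTilting k A M → IsBasicMod A M →
      ∃ i, Nonempty (M ≃ₗ[Aᵐᵒᵖ] R i)

/-- `A` is representation-finite: it has only finitely many isomorphism classes of finitely
generated indecomposable right modules. -/
def RepresentationFinite : Prop :=
  ∃ (n : ℕ) (R : Fin n → ModuleCat.{0} Aᵐᵒᵖ),
    ∀ M : ModuleCat.{0} Aᵐᵒᵖ, Module.Finite Aᵐᵒᵖ M → IndecomposableMod A M →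
      ∃ i, Nonempty (M ≃ₗ[Aᵐᵒᵖ] R i)

end Support

section QuiverAlg
variable (k : Type) [Field k]

/-- The product in the path algebra of a word of arrows (paths are composed from left to
right, so the path `α₁α₂` corresponds to the product `α₁ * α₂`). -/
def arrWord {V E : Type} (l : List E) : FreeAlgebra k (V ⊕ E) :=
  (l.map (fun a => FreeAlgebra.ι k (Sum.inr a))).prod

/-- The defining relations of a bound quiver algebra `kQ/I`: the vertices `e_v` are orthogonal
idempotents summing to `1`, each arrow `a : u → v` satisfies `e_u a = a = a e_v`, and the
extra relations generating the admissible ideal `I` hold. -/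
def quivRel {V E : Type} [Fintype V] [DecidableEq V] (s t : E → V)
    (extra : FreeAlgebra k (V ⊕ E) → FreeAlgebra k (V ⊕ E) → Prop) :
    FreeAlgebra k (V ⊕ E) → FreeAlgebra k (V ⊕ E) → Prop := fun x y =>
  (∃ v w : V, x = FreeAlgebra.ι k (Sum.inl v) * FreeAlgebra.ι k (Sum.inl w) ∧
    y = if v = w then FreeAlgebra.ι k (Sum.inl v) else 0) ∨
  (x = ∑ v : V, FreeAlgebra.ι k (Sum.inl v) ∧ y = 1) ∨
  (∃ a : E, x = FreeAlgebra.ι k (Sum.inl (s a)) * FreeAlgebra.ι k (Sum.inr a) ∧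
    y = FreeAlgebra.ι k (Sum.inr a)) ∨
  (∃ a : E, x = FreeAlgebra.ι k (Sum.inr a) * FreeAlgebra.ι k (Sum.inl (t a)) ∧
    y = FreeAlgebra.ι k (Sum.inr a)) ∨
  extra x y

/-- The bound quiver algebra presented by a quiver `(V, E, s, t)` and extra relations. -/
def BoundQuiverAlg {V E : Type} [Fintype V] [DecidableEq V] (s t : E → V)
    (extra : FreeAlgebra k (V ⊕ E) → FreeAlgebra k (V ⊕ E) → Prop) : Type :=
  RingQuot (quivRel k s t extra)

instance {V E : Type} [Fintype V] [DecidableEq V] (s t : E → V)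
    (extra : FreeAlgebra k (V ⊕ E) → FreeAlgebra k (V ⊕ E) → Prop) :
    Ring (BoundQuiverAlg k s t extra) :=
  inferInstanceAs (Ring (RingQuot (quivRel k s t extra)))

instance {V E : Type} [Fintype V] [DecidableEq V] (s t : E → V)
    (extra : FreeAlgebra k (V ⊕ E) → FreeAlgebra k (V ⊕ E) → Prop) :
    Algebra k (BoundQuiverAlg k s t extra) :=
  inferInstanceAs (Algebra k (RingQuot (quivRel k s t extra)))

end QuiverAlg

section QuiverAlg
variable (k : Type) [Field k]

/-! ### The quiver `Δ(p,q)`: two oriented cycles of lengths `p` and `q` glued at a vertex `0` -/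

/-- Vertices of `Δ(p,q)`: `none` is the common vertex `0`. -/
def CycV (p q : ℕ) : Type := Option ({i : ZMod p // i ≠ 0} ⊕ {j : ZMod q // j ≠ 0})

/-- The vertex of the `α`-cycle with index `i`. -/
def cycVL (p q : ℕ) (i : ZMod p) : CycV p q :=
  if h : i = 0 then none else some (Sum.inl ⟨i, h⟩)

/-- The vertex of the `β`-cycle with index `j`. -/
def cycVR (p q : ℕ) (j : ZMod q) : CycV p q :=
  if h : j = 0 then none else some (Sum.inr ⟨j, h⟩)

instance (p q : ℕ) : DecidableEq (CycV p q) :=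
  inferInstanceAs (DecidableEq (Option ({i : ZMod p // i ≠ 0} ⊕ {j : ZMod q // j ≠ 0})))

instance (p q : ℕ) [NeZero p] [NeZero q] : Fintype (CycV p q) :=
  inferInstanceAs (Fintype (Option ({i : ZMod p // i ≠ 0} ⊕ {j : ZMod q // j ≠ 0})))

/-- Arrows of `Δ(p,q)`: `Sum.inl i` is the arrow `α_{i+1}`, `Sum.inr j` is `β_{j+1}`. -/
def CycE (p q : ℕ) : Type := ZMod p ⊕ ZMod q

def cycSrc (p q : ℕ) : CycE p q → CycV p q
  | Sum.inl i => cycVL p q i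
  | Sum.inr j => cycVR p q j

def cycTgt (p q : ℕ) : CycE p q → CycV p q
  | Sum.inl i => cycVL p q (i + 1)
  | Sum.inr j => cycVR p q (j + 1)

/-- The word `α_{s+1} α_{s+2} ⋯ α_{s+len}` of arrows on the `α`-cycle of `Δ(p,q)`. -/
def aw (p q : ℕ) (st len : ℕ) : List (CycE p q) :=
  (List.range len).map (fun u => Sum.inl ((st + u : ℕ) : ZMod p))

/-- The word `β_{s+1} β_{s+2} ⋯ β_{s+len}` of arrows on the `β`-cycle of `Δ(p,q)`. -/
def bw (p q : ℕ) (st len : ℕ) : List (CycE p q) :=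
  (List.range len).map (fun u => Sum.inr ((st + u : ℕ) : ZMod q))

section TwoCycles
variable (p q : ℕ)

/-- The relations `I₁(p,q)` of the algebra `A(p,q)`. -/
def ARelExtra : FreeAlgebra k (CycV p q ⊕ CycE p q) → FreeAlgebra k (CycV p q ⊕ CycE p q) →
    Prop := fun x y =>
  (x = arrWord k (aw p q 0 p ++ bw p q 0 q) ∧ y = arrWord k (bw p q 0 q ++ aw p q 0 p)) ∨
  (x = arrWord k (aw p q (p - 1) 1 ++ aw p q 0 1) ∧ y = 0) ∨
  (x = arrWord k (bw p q (q - 1) 1 ++ bw p q 0 1) ∧ y = 0) ∨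
  (∃ i : ℕ, 2 ≤ i ∧ i ≤ p - 1 ∧
    x = arrWord k (aw p q (i - 1) (p - i + 1) ++ bw p q 0 q ++ aw p q 0 i) ∧ y = 0) ∨
  (∃ j : ℕ, 2 ≤ j ∧ j ≤ q - 1 ∧
    x = arrWord k (bw p q (j - 1) (q - j + 1) ++ aw p q 0 p ++ bw p q 0 j) ∧ y = 0)

/-- The algebra `A(p,q) = kΔ(p,q)/I₁(p,q)`. -/
def AAlg (_ : 0 < p) (_ : 0 < q) : Type :=
  haveI : NeZero p := ⟨by omega⟩
  haveI : NeZero q := ⟨by omega⟩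
  BoundQuiverAlg k (cycSrc p q) (cycTgt p q) (ARelExtra k p q)

instance (hp : 0 < p) (hq : 0 < q) : Ring (AAlg k p q hp hq) :=
  haveI : NeZero p := ⟨by omega⟩
  haveI : NeZero q := ⟨by omega⟩
  inferInstanceAs (Ring (BoundQuiverAlg k (cycSrc p q) (cycTgt p q) (ARelExtra k p q)))

instance (hp : 0 < p) (hq : 0 < q) : Algebra k (AAlg k p q hp hq) :=
  haveI : NeZero p := ⟨by omega⟩
  haveI : NeZero q := ⟨by omega⟩
  inferInstanceAs (Algebra k (BoundQuiverAlg k (cycSrc p q) (cycTgt p q) (ARelExtra k p q)))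

/-- The relations `I₂(m)` of the algebra `Λ(m)` (on the quiver `Δ(1,m)`). -/
def LamRelExtra (m : ℕ) : FreeAlgebra k (CycV 1 m ⊕ CycE 1 m) →
    FreeAlgebra k (CycV 1 m ⊕ CycE 1 m) → Prop := fun x y =>
  (x = arrWord k (aw 1 m 0 1 ++ aw 1 m 0 1) ∧
    y = arrWord k (bw 1 m 0 m ++ bw 1 m 0 m)) ∨
  (x = arrWord k (aw 1 m 0 1 ++ bw 1 m 0 1) ∧ y = 0) ∨
  (x = arrWord k (bw 1 m (m - 1) 1 ++ aw 1 m 0 1) ∧ y = 0) ∨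
  (∃ j : ℕ, 2 ≤ j ∧ j ≤ m - 1 ∧
    x = arrWord k (bw 1 m (j - 1) (m - j + 1) ++ bw 1 m 0 m ++ bw 1 m 0 j) ∧ y = 0)

/-- The algebra `Λ(m) = kΔ(1,m)/I₂(m)`. -/
def LamAlg (m : ℕ) (_ : 0 < m) : Type :=
  haveI : NeZero m := ⟨by omega⟩
  BoundQuiverAlg k (cycSrc 1 m) (cycTgt 1 m) (LamRelExtra k m)

instance (m : ℕ) (hm : 0 < m) : Ring (LamAlg k m hm) :=
  haveI : NeZero m := ⟨by omega⟩
  inferInstanceAs (Ring (BoundQuiverAlg k (cycSrc 1 m) (cycTgt 1 m) (LamRelExtra k m)))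

instance (m : ℕ) (hm : 0 < m) : Algebra k (LamAlg k m hm) :=
  haveI : NeZero m := ⟨by omega⟩
  inferInstanceAs (Algebra k (BoundQuiverAlg k (cycSrc 1 m) (cycTgt 1 m) (LamRelExtra k m)))

/-- The relations `I₇(n)` of the algebra `Ω(n)` (on the quiver `Δ(1,n)`). -/
def OmRelExtra (n : ℕ) : FreeAlgebra k (CycV 1 n ⊕ CycE 1 n) →
    FreeAlgebra k (CycV 1 n ⊕ CycE 1 n) → Prop := fun x y =>
  (x = arrWord k (aw 1 n 0 1 ++ bw 1 n 0 n) + arrWord k (bw 1 n 0 n ++ aw 1 n 0 1) ∧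
    y = 0) ∨
  (x = arrWord k (aw 1 n 0 1 ++ aw 1 n 0 1) ∧
    y = arrWord k (aw 1 n 0 1 ++ bw 1 n 0 n)) ∨
  (x = arrWord k (bw 1 n (n - 1) 1 ++ bw 1 n 0 1) ∧ y = 0) ∨
  (∃ j : ℕ, 2 ≤ j ∧ j ≤ n - 1 ∧
    x = arrWord k (bw 1 n (j - 1) (n - j + 1) ++ aw 1 n 0 1 ++ bw 1 n 0 j) ∧ y = 0)

/-- The algebra `Ω(n) = kΔ(1,n)/I₇(n)`. -/
def OmAlg (n : ℕ) (_ : 0 < n) : Type :=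
  haveI : NeZero n := ⟨by omega⟩
  BoundQuiverAlg k (cycSrc 1 n) (cycTgt 1 n) (OmRelExtra k n)

instance (n : ℕ) (hn : 0 < n) : Ring (OmAlg k n hn) :=
  haveI : NeZero n := ⟨by omega⟩
  inferInstanceAs (Ring (BoundQuiverAlg k (cycSrc 1 n) (cycTgt 1 n) (OmRelExtra k n)))

instance (n : ℕ) (hn : 0 < n) : Algebra k (OmAlg k n hn) :=
  haveI : NeZero n := ⟨by omega⟩
  inferInstanceAs (Algebra k (BoundQuiverAlg k (cycSrc 1 n) (cycTgt 1 n) (OmRelExtra k n)))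

end TwoCycles
end QuiverAlg

/-! ### Generation, Ext-vanishing and bricks -/

section Torsion

variable {R : Type} [Ring R]

/-- `Y` is generated by `U`: it is the sum of the images of all homomorphisms `U → Y`. -/
def Gen (R : Type) [Ring R] (U Y : Type) [AddCommGroup U] [Module R U] [AddCommGroup Y]
    [Module R Y] : Prop :=
  (⨆ f : U →ₗ[R] Y, LinearMap.range f) = ⊤

/-- Homomorphisms from `U` lift along every epimorphism whose kernel is generated by `U`, i.e.
`Ext¹(U, -)` vanishes on the modules generated by `U`. -/
def ExtVanish (R : Type) [Ring R] (U : Type) [AddCommGroup U] [Module R U] : Prop :=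
  ∀ (X Z : Type) [AddCommGroup X] [Module R X] [AddCommGroup Z] [Module R Z] [IsNoetherian R X]
    (π : X →ₗ[R] Z), Function.Surjective π → Gen R U (LinearMap.ker π) →
    ∀ h : U →ₗ[R] Z, ∃ h' : U →ₗ[R] X, π ∘ₗ h' = h

/-- A nonzero module all of whose nonzero endomorphisms are bijective. -/
def IsBrick (R : Type) [Ring R] (Y : Type) [AddCommGroup Y] [Module R Y] : Prop :=
  Nontrivial Y ∧ ∀ f : Y →ₗ[R] Y, f ≠ 0 → Function.Bijective f

variable {U U' Y Z : Type} [AddCommGroup U] [Module R U] [AddCommGroup U'] [Module R U']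
  [AddCommGroup Y] [Module R Y] [AddCommGroup Z] [Module R Z]

theorem gen_of_forall (h : ∀ y : Y, ∃ f : U →ₗ[R] Y, y ∈ LinearMap.range f) : Gen R U Y := by
  refine eq_top_iff.2 fun y _ => ?_
  obtain ⟨f, hf⟩ := h y
  exact Submodule.mem_iSup_of_mem f hf

theorem Gen.of_surjective (h : Gen R U Y) (g : Y →ₗ[R] Z) (hg : Function.Surjective g) :
    Gen R U Z := by
  refine eq_top_iff.2 ?_
  rw [← LinearMap.range_eq_top.2 hg, LinearMap.range_eq_map, ← h, Submodule.map_iSup]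
  refine iSup_le fun f => ?_
  rw [← LinearMap.range_comp]
  exact le_iSup (fun f : U →ₗ[R] Z => LinearMap.range f) (g ∘ₗ f)

theorem Gen.trans (h' : Gen R U' U) (h : Gen R U Y) : Gen R U' Y := by
  refine eq_top_iff.2 ?_
  rw [← h]
  refine iSup_le fun f => ?_
  rw [LinearMap.range_eq_map, ← h', Submodule.map_iSup]
  refine iSup_le fun g => ?_
  rw [← LinearMap.range_comp]
  exact le_iSup (fun f : U' →ₗ[R] Y => LinearMap.range f) (f ∘ₗ g)

theorem Gen.congr (h : Gen R U Y) (e : Y ≃ₗ[R] Z) : Gen R U Z :=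
  h.of_surjective e.toLinearMap e.surjective

theorem Gen.apply_mem (h : Gen R U Y) (g : Y →ₗ[R] Z) (y : Y) :
    g y ∈ (⨆ f : U →ₗ[R] Z, LinearMap.range f) := by
  have hy : g y ∈ Submodule.map g ⊤ := Submodule.mem_map_of_mem trivial
  rw [← h, Submodule.map_iSup] at hy
  refine iSup_le (a := ⨆ f : U →ₗ[R] Z, LinearMap.range f) (fun f => ?_) hy
  rw [← LinearMap.range_comp]
  exact le_iSup (fun f : U →ₗ[R] Z => LinearMap.range f) (g ∘ₗ f)

theorem Gen.prod (hY : Gen R U Y) (hZ : Gen R U Z) : Gen R U (Y × Z) := by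
  refine eq_top_iff.2 fun w _ => ?_
  have e : w = LinearMap.inl R Y Z w.1 + LinearMap.inr R Y Z w.2 := by simp
  rw [e]
  exact add_mem (hY.apply_mem _ _) (hZ.apply_mem _ _)

theorem gen_pi (n : ℕ) : Gen R U (Fin n → U) := by
  refine eq_top_iff.2 fun v _ => ?_
  rw [← Finset.univ_sum_single v]
  exact Submodule.sum_mem _ fun i _ =>
    Submodule.mem_iSup_of_mem (LinearMap.single R (fun _ => U) i) ⟨v i, rfl⟩

theorem Gen.exists_surjective [Module.Finite R Y] (h : Gen R U Y) :
    ∃ (n : ℕ) (π : (Fin n → U) →ₗ[R] Y), Function.Surjective π := by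
  have hc := (Submodule.fg_iff_compact (⊤ : Submodule R Y)).1 Module.Finite.fg_top
  obtain ⟨s, hs⟩ := (CompleteLattice.isCompactElement_iff_exists_le_iSup_of_le_iSup _).1 hc _ 
    (fun f : U →ₗ[R] Y => LinearMap.range f) h.ge
  let e := s.equivFin
  refine ⟨s.card, LinearMap.lsum R (fun _ => U) ℕ fun i => (e.symm i : U →ₗ[R] Y), ?_⟩
  rw [← LinearMap.range_eq_top, eq_top_iff]
  refine hs.trans (Finset.sup_le fun f hf => ?_)
  rintro _ ⟨u, rfl⟩
  refine ⟨Pi.single (e ⟨f, hf⟩) u, ?_⟩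
  simp [LinearMap.lsum_apply, Pi.single_apply, Finset.sum_apply]
  rw [Finset.sum_eq_single (e ⟨f, hf⟩)] <;> simp +contextual

theorem ExtVanish.congr (h : ExtVanish R U) (e : U ≃ₗ[R] U') : ExtVanish R U' := by
  intro X Z _ _ _ _ _ π hπ hg f
  obtain ⟨f', hf'⟩ := h X Z π hπ
    (Gen.trans (gen_of_forall fun y => ⟨e.toLinearMap, e.surjective y⟩) hg) (f ∘ₗ e.toLinearMap)
  refine ⟨f' ∘ₗ e.symm.toLinearMap, ?_⟩
  rw [← LinearMap.comp_assoc, hf', LinearMap.comp_assoc]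
  ext x
  simp

/-- If `U'` is not generated by `U`, there is a brick which is generated by `U'` and receives no
nonzero homomorphism from `U`. -/
theorem exists_brick_of_not_gen [IsNoetherian R U'] [IsArtinian R U'] (hU : ExtVanish R U)
    (h : ¬ Gen R U U') :
    ∃ (Q : Submodule R U') (B : Submodule R (U' ⧸ Q)), IsBrick R B ∧ Gen R U' B ∧ ¬ Gen R U B := by
  set Q : Submodule R U' := ⨆ f : U →ₗ[R] U', LinearMap.range f with hQ
  have hQtop : Q ≠ ⊤ := h
  have hQgen : Gen R U Q := by
    refine eq_top_iff.2 fun y _ => ?_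
    obtain ⟨y, hy⟩ := y
    have : Submodule.map Q.subtype (⨆ f : U →ₗ[R] Q, LinearMap.range f) = Q := by
      apply le_antisymm (Submodule.map_subtype_le _ _)
      conv_lhs => rw [hQ]
      refine iSup_le fun f => ?_
      rw [Submodule.map_iSup]
      have hf : ∀ u, f u ∈ Q := fun u => Submodule.mem_iSup_of_mem f ⟨u, rfl⟩
      refine le_trans ?_ (le_iSup _ (f.codRestrict Q hf))
      rintro _ ⟨u, rfl⟩
      exact ⟨_, ⟨u, rfl⟩, rfl⟩
    rw [← this] at hy
    obtain ⟨z, hz, hzy⟩ := hy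
    have : z = ⟨y, hy⟩ := Subtype.ext hzy
    exact this ▸ hz
  have hzero : ∀ f : U →ₗ[R] (U' ⧸ Q), f = 0 := by
    intro f
    obtain ⟨f', hf'⟩ := hU U' (U' ⧸ Q) Q.mkQ Q.mkQ_surjective
      (by rw [Submodule.ker_mkQ]; exact hQgen) f
    rw [← hf']
    ext u
    simpa using Submodule.mem_iSup_of_mem f' (LinearMap.mem_range_self f' u)
  let S : Set (Submodule R (U' ⧸ Q)) := {B | B ≠ ⊥ ∧ Gen R U' B}
  have hS : S.Nonempty := by
    refine ⟨⊤, ?_, ?_⟩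
    · have : Nontrivial (U' ⧸ Q) := Submodule.Quotient.nontrivial_iff.2 hQtop
      exact top_ne_bot
    · refine Gen.congr ?_ Submodule.topEquiv.symm
      exact gen_of_forall fun y => ⟨Q.mkQ, Q.mkQ_surjective y⟩
  obtain ⟨B, ⟨hB0, hBg⟩, hBmin⟩ := IsArtinian.set_has_minimal S hS
  have hBn : Nontrivial B := Submodule.nontrivial_iff_ne_bot.2 hB0
  refine ⟨Q, B, ⟨hBn, fun f hf => ?_⟩, hBg, fun hg => ?_⟩
  · have hr : LinearMap.range f = ⊤ := by
      by_contra hr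
      refine hBmin (Submodule.map B.subtype (LinearMap.range f)) ⟨?_, ?_⟩ ?_
      · intro h0
        refine hf (LinearMap.range_eq_bot.1 ?_)
        exact Submodule.map_injective_of_injective B.injective_subtype (by rw [h0,
            Submodule.map_bot])
      · have h1 : Gen R U' (LinearMap.range f) :=
          hBg.of_surjective f.rangeRestrict f.surjective_rangeRestrict
        exact h1.congr (Submodule.equivMapOfInjective B.subtype B.injective_subtype _)
      · refine lt_of_le_of_ne (Submodule.map_subtype_le _ _) fun he => hr ?_
        rw [eq_top_iff]
        rintro ⟨b, hb⟩ -
        rw [← he] at hb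
        obtain ⟨c, hc, hcb⟩ := hb
        have : c = ⟨b, he ▸ hb⟩ := Subtype.ext hcb
        exact this ▸ hc
    have hsurj := LinearMap.range_eq_top.1 hr
    exact ⟨IsNoetherian.injective_of_surjective_endomorphism f hsurj, hsurj⟩
  · have : (⊤ : Submodule R B) ≤ ⊥ := by
      rw [← hg]
      refine iSup_le fun f => ?_
      have : f = 0 := by
        ext u
        have := LinearMap.congr_fun (hzero (B.subtype ∘ₗ f)) u
        simpa using this
      simp [this]
    exact top_ne_bot (le_bot_iff.1 this)

end Torsion

/-! ### Mutual generation of Ext-projective modules -/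

section ExtProjective

/-- `X` is a direct summand of `W`. -/
def IsRetractOf (R : Type) [Ring R] (X W : Type) [AddCommGroup X] [Module R X] [AddCommGroup W]
    [Module R W] : Prop :=
  ∃ (i : X →ₗ[R] W) (r : W →ₗ[R] X), r ∘ₗ i = LinearMap.id

variable (k : Type) [Field k] {R : Type} [Ring R] [Algebra k R]
variable {U X : Type} [AddCommGroup U] [Module R U] [Module k U] [IsScalarTower k R U]
  [Module.Finite k U] [AddCommGroup X] [Module R X] [Module k X] [IsScalarTower k R X]
  [Module.Finite k X]

theorem finite_hom (W : Type) [AddCommGroup W] [Module R W] [Module k W] [IsScalarTower k R W]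
    [Module.Finite k W] : Module.Finite k (W →ₗ[R] X) := by
  let φ : (W →ₗ[R] X) →ₗ[k] (W →ₗ[k] X) :=
    { toFun := fun f => f.restrictScalars k
      map_add' := fun _ _ => rfl
      map_smul' := fun _ _ => rfl }
  exact Module.Finite.of_injective φ (LinearMap.restrictScalars_injective k)

/-- The universal element of a power of `U`, all of whose coordinates form a `k`-basis of `U`. -/
def univElem (U : Type) [AddCommGroup U] [Module k U] [Module.Finite k U] :
    Fin (Module.finrank k U) → U :=
  fun i => Module.finBasis k U i

theorem Gen.exists_univElem_eq {Y : Type} [AddCommGroup Y] [Module R Y] (h : Gen R U Y) (y : Y) :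
    ∃ φ : (Fin (Module.finrank k U) → U) →ₗ[R] Y, φ (univElem k U) = y := by
  have hy : y ∈ (⨆ f : U →ₗ[R] Y, LinearMap.range f) := by rw [h]; trivial
  refine Submodule.iSup_induction _ (motive := fun y => ∃ φ : (Fin (Module.finrank k U) → U) →ₗ[R]
      Y,
    φ (univElem k U) = y) hy ?_ ⟨0, rfl⟩ ?_
  · rintro f _ ⟨u, rfl⟩
    refine ⟨f ∘ₗ ∑ j, ((Module.finBasis k U).repr u j) • LinearMap.proj j, ?_⟩
    simp only [LinearMap.comp_apply, LinearMap.sum_apply, LinearMap.smul_apply,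
        LinearMap.proj_apply,
      univElem]
    rw [Module.Basis.sum_repr]
  · rintro _ _ ⟨φ, rfl⟩ ⟨ψ, rfl⟩
    exact ⟨φ + ψ, rfl⟩

/-- A module of which every Ext-projective module generating the same modules as `U` is a summand
of a power. -/
abbrev GenCover (R : Type) [Ring R] [Algebra k R] (U : Type) [AddCommGroup U] [Module R U]
    [Module k U] [IsScalarTower k R U] [Module.Finite k U] : Type :=
  (Fin (Module.finrank k U) → U) × ((Fin (Module.finrank k U) → U) ⧸ Submodule.span R {univElem k
      U})

theorem isRetractOf_genCover (hE : ExtVanish R X) (h1 : Gen R U X) (h2 : Gen R X U) :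
    ∃ N : ℕ, IsRetractOf R X (Fin N → GenCover k R U) := by
  have : Module.Finite k (GenCover k R U →ₗ[R] X) := finite_hom k _
  set N := Module.finrank k (GenCover k R U →ₗ[R] X)
  let b := Module.finBasis k (GenCover k R U →ₗ[R] X)
  let π : (Fin N → GenCover k R U) →ₗ[R] X := ∑ j, b j ∘ₗ LinearMap.proj j
  have hlift : ∀ h : GenCover k R U →ₗ[R] X, ∃ h' : GenCover k R U →ₗ[R] (Fin N → GenCover k R U),
      π ∘ₗ h' = h := by
    intro h
    refine ⟨LinearMap.pi fun j => b.repr h j • LinearMap.id, ?_⟩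
    conv_rhs => rw [← b.sum_repr h]
    refine LinearMap.ext fun x => ?_
    simp only [π, LinearMap.comp_apply, LinearMap.sum_apply, LinearMap.proj_apply,
      LinearMap.pi_apply, LinearMap.smul_apply, LinearMap.id_apply]
    exact Finset.sum_congr rfl fun j _ => (b j).map_smul_of_tower _ _
  have hgen : Gen R (GenCover k R U) U := by
    refine gen_of_forall fun u => ?_
    by_cases hn : Module.finrank k U = 0
    · have := Module.finrank_zero_iff.1 hn
      exact ⟨0, 0, Subsingleton.elim _ _⟩
    · exact ⟨LinearMap.proj ⟨0, Nat.pos_of_ne_zero hn⟩ ∘ₗ LinearMap.fst R _ _, (fun _ => u, 0), rfl⟩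
  have hsurj : Function.Surjective π := by
    rw [← LinearMap.range_eq_top, eq_top_iff, ← hgen.trans h1]
    refine iSup_le fun h => ?_
    obtain ⟨h', rfl⟩ := hlift h
    exact LinearMap.range_comp_le_range _ _
  have hker : Gen R U (LinearMap.ker π) := by
    refine (gen_pi (R := R) (U := U) (Module.finrank k U)).trans (gen_of_forall fun l => ?_)
    have hV : Gen R U (Fin N → GenCover k R U) := by
      refine Gen.trans ?_ (gen_pi N)
      have g0 := gen_pi (R := R) (U := U) (Module.finrank k U)
      exact g0.prod (g0.of_surjective (Submodule.mkQ _) (Submodule.mkQ_surjective _))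
    obtain ⟨φ, hφ⟩ := hV.exists_univElem_eq k (l : Fin N → GenCover k R U)
    let ψ := (Submodule.span R {univElem k U}).liftQ (π ∘ₗ φ) (by
      rw [Submodule.span_singleton_le_iff_mem, LinearMap.mem_ker, LinearMap.comp_apply, hφ]
      exact l.2)
    obtain ⟨ψ', hψ'⟩ := hlift (ψ ∘ₗ LinearMap.snd R _ _)
    refine ⟨(φ - ψ' ∘ₗ LinearMap.inr R _ _ ∘ₗ Submodule.mkQ _).codRestrict _ fun x => ?_, univElem
        k U, ?_⟩
    · have := LinearMap.congr_fun hψ' (LinearMap.inr R _ _ (Submodule.mkQ _ x))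
      simp only [LinearMap.comp_apply, LinearMap.mem_ker, LinearMap.sub_apply, map_sub] at this ⊢
      rw [this]
      simp [ψ]
    · apply Subtype.ext
      have : Submodule.mkQ (Submodule.span R {univElem k U}) (univElem k U) = 0 := by
        simp [Submodule.mem_span_singleton_self]
      simp only [LinearMap.codRestrict_apply, LinearMap.sub_apply, LinearMap.comp_apply, this, hφ,
        map_zero, sub_zero]
  have : IsNoetherian R (Fin N → GenCover k R U) := isNoetherian_of_tower k inferInstance
  obtain ⟨s, hs⟩ := hE _ _ π hsurj (h2.trans hker) LinearMap.id
  exact ⟨N, s, π, hs⟩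

end ExtProjective

/-! ### Finitely many basic summands of powers of a finite-dimensional module -/

section KrullSchmidt

variable {R : Type} [Ring R]

/-- A nonzero module without nontrivial direct sum decomposition. -/
def Indec (R : Type) [Ring R] (Y : Type) [AddCommGroup Y] [Module R Y] : Prop :=
  Nontrivial Y ∧ ∀ p q : Submodule R Y, IsCompl p q → p = ⊥ ∨ q = ⊥

section

variable {L W W' : Type} [AddCommGroup L] [Module R L] [AddCommGroup W] [Module R W]
  [AddCommGroup W'] [Module R W']

theorem IsRetractOf.trans (h : IsRetractOf R L W) (h' : IsRetractOf R W W') :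
    IsRetractOf R L W' := by
  obtain ⟨i, r, h⟩ := h
  obtain ⟨i', r', h'⟩ := h'
  refine ⟨i' ∘ₗ i, r ∘ₗ r', LinearMap.ext fun x => ?_⟩
  have h1 := LinearMap.congr_fun h' (i x)
  have h2 := LinearMap.congr_fun h x
  simp only [LinearMap.comp_apply, LinearMap.id_apply] at h1 h2 ⊢
  rw [h1, h2]

theorem isRetractOf_of_equiv (e : L ≃ₗ[R] W) : IsRetractOf R L W :=
  ⟨e.toLinearMap, e.symm.toLinearMap, by ext; simp⟩

theorem isRetractOf_prod_left : IsRetractOf R L (L × W) :=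
  ⟨LinearMap.inl R L W, LinearMap.fst R L W, rfl⟩

theorem isRetractOf_prod_right : IsRetractOf R W (L × W) :=
  ⟨LinearMap.inr R L W, LinearMap.snd R L W, rfl⟩

theorem Indec.isNilpotent_or_bijective [IsNoetherian R L] [IsArtinian R L] (h : Indec R L)
    (f : L →ₗ[R] L) : IsNilpotent f ∨ Function.Bijective f := by
  obtain ⟨n, hn, hn1⟩ := ((f.eventually_isCompl_ker_pow_range_pow).and
    (Filter.eventually_ge_atTop 1)).exists
  rcases h.2 _ _ hn with h0 | h0
  · right
    have : Function.Injective f := by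
      have := LinearMap.ker_eq_bot.1 h0
      obtain ⟨m, rfl⟩ : ∃ m, n = m + 1 := ⟨n - 1, by omega⟩
      rw [pow_succ] at this
      exact Function.Injective.of_comp (f := (f ^ m : Module.End R L)) this
    exact IsArtinian.bijective_of_injective_endomorphism f this
  · exact Or.inl ⟨n, LinearMap.range_eq_bot.1 h0⟩

theorem Indec.isRetractOf_or [IsNoetherian R L] [IsArtinian R L] (h : Indec R L)
    (hr : IsRetractOf R L (W × W')) : IsRetractOf R L W ∨ IsRetractOf R L W' := by
  obtain ⟨i, r, hir⟩ := hr
  let f : Module.End R L := r ∘ₗ LinearMap.inl R W W' ∘ₗ LinearMap.fst R W W' ∘ₗ i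
  let g : Module.End R L := r ∘ₗ LinearMap.inr R W W' ∘ₗ LinearMap.snd R W W' ∘ₗ i
  have hfg : g = 1 - f := by
    rw [eq_sub_iff_add_eq]
    refine LinearMap.ext fun x => ?_
    have := LinearMap.congr_fun hir x
    simp only [LinearMap.comp_apply, LinearMap.id_apply] at this
    simp only [f, g, LinearMap.add_apply, LinearMap.comp_apply, Module.End.one_apply, ← map_add]
    simpa using this
  rcases h.isNilpotent_or_bijective f with hf | hf
  · right
    have hg : Function.Bijective g := by
      rw [← Module.End.isUnit_iff, hfg]
      exact hf.isUnit_one_sub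
    let e := LinearEquiv.ofBijective g hg
    refine ⟨LinearMap.snd R W W' ∘ₗ i, e.symm.toLinearMap ∘ₗ r ∘ₗ LinearMap.inr R W W', ?_⟩
    exact LinearMap.ext fun x => e.symm_apply_apply x
  · left
    let e := LinearEquiv.ofBijective f hf
    refine ⟨LinearMap.fst R W W' ∘ₗ i, e.symm.toLinearMap ∘ₗ r ∘ₗ LinearMap.inl R W W', ?_⟩
    exact LinearMap.ext fun x => e.symm_apply_apply x

theorem Indec.isRetractOf_of_pi [IsNoetherian R L] [IsArtinian R L] (h : Indec R L) {N : ℕ}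
    (hr : IsRetractOf R L (Fin N → W)) : IsRetractOf R L W := by
  induction N with
  | zero =>
    obtain ⟨i, r, hir⟩ := hr
    obtain ⟨x, hx⟩ := @exists_ne L h.1 0
    refine absurd ?_ hx
    have := LinearMap.congr_fun hir x
    simp only [LinearMap.comp_apply, LinearMap.id_apply] at this
    rw [← this, Subsingleton.elim (i x) 0, map_zero]
  | succ n ih =>
    rcases h.isRetractOf_or (hr.trans (isRetractOf_of_equiv (Fin.consLinearEquiv R (fun _ =>
        W)).symm))
      with h | h
    · exact h
    · exact ih h

theorem Indec.equiv_of_isRetractOf (h : Indec R W) [Nontrivial L] (hr : IsRetractOf R L W) :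
    Nonempty (L ≃ₗ[R] W) := by
  obtain ⟨i, r, hir⟩ := hr
  have hi : ∀ x, r (i x) = x := fun x => LinearMap.congr_fun hir x
  have hinj : Function.Injective i := Function.LeftInverse.injective hi
  have hc : IsCompl (LinearMap.range i) (LinearMap.ker r) := by
    constructor
    · rw [Submodule.disjoint_def]
      rintro _ ⟨x, rfl⟩ hx
      rw [LinearMap.mem_ker, hi] at hx
      rw [hx, map_zero]
    · rw [codisjoint_iff, eq_top_iff]
      intro w _
      have : w = i (r w) + (w - i (r w)) := by abel
      rw [this]
      refine Submodule.add_mem_sup ⟨_, rfl⟩ ?_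
      rw [LinearMap.mem_ker, map_sub, hi, sub_self]
  rcases h.2 _ _ hc with h0 | h0
  · rw [LinearMap.range_eq_bot] at h0
    obtain ⟨x, hx⟩ := exists_ne (0 : L)
    exact absurd (by rw [← hi x, h0]; simp) hx
  · refine ⟨(LinearEquiv.ofBijective r ⟨LinearMap.ker_eq_bot.1 h0, fun x => ⟨i x, hi x⟩⟩).symm⟩

end

section

variable (k : Type) [Field k] [Algebra k R]

theorem finite_submodule {W : Type} [AddCommGroup W] [Module R W] [Module k W]
    [IsScalarTower k R W] [Module.Finite k W] (p : Submodule R W) : Module.Finite k p :=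
  inferInstanceAs (Module.Finite k (p.restrictScalars k))

theorem exists_isCompl_finrank_lt {W : Type} [AddCommGroup W] [Module R W] [Module k W]
    [IsScalarTower k R W] [Module.Finite k W] [Nontrivial W] (h : ¬ Indec R W) :
    ∃ p q : Submodule R W, IsCompl p q ∧ Module.finrank k p < Module.finrank k W ∧
      Module.finrank k q < Module.finrank k W := by
  simp only [Indec, not_and, not_forall, not_or] at h
  obtain ⟨p, q, hc, hp, hq⟩ := h inferInstance
  have key : ∀ p q : Submodule R W, IsCompl p q → q ≠ ⊥ →
      Module.finrank k p < Module.finrank k W := by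
    intro p q hc hq
    refine Submodule.finrank_lt (s := p.restrictScalars k) fun h => hq ?_
    have : p = ⊤ := (Submodule.restrictScalars_eq_top_iff k R W).1 h
    rw [this] at hc
    simpa using hc.disjoint
  exact ⟨p, q, hc, key p q hc hq, key q p hc.symm hp⟩

theorem finite_indec_retracts (d : ℕ) : ∀ (W : Type) [AddCommGroup W] [Module R W] [Module k W]
    [IsScalarTower k R W] [Module.Finite k W], Module.finrank k W ≤ d →
    ∃ (ι : Type) (_ : Finite ι) (X : ι → ModuleCat.{0} R), (∀ i, Nontrivial (X i)) ∧
      ∀ (L : Type) [AddCommGroup L] [Module R L] [IsNoetherian R L] [IsArtinian R L], Indec R L →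
        IsRetractOf R L W → ∃ i, Nonempty (L ≃ₗ[R] X i) := by
  induction d with
  | zero =>
    intro W _ _ _ _ _ hd
    refine ⟨Empty, inferInstance, Empty.rec, Empty.rec, ?_⟩
    intro L _ _ _ _ hL ⟨i, r, hir⟩
    have := Module.finrank_zero_iff.1 (Nat.le_zero.1 hd)
    obtain ⟨x, hx⟩ := @exists_ne L hL.1 0
    refine absurd ?_ hx
    rw [← LinearMap.id_apply (R := R) x, ← hir, LinearMap.comp_apply, Subsingleton.elim (i x) 0,
        map_zero]
  | succ d ih =>
    intro W _ _ _ _ _ hd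
    by_cases hle : Module.finrank k W ≤ d
    · exact ih W hle
    have : Nontrivial W := Module.nontrivial_of_finrank_pos (R := k) (by omega)
    by_cases hW : Indec R W
    · refine ⟨Unit, inferInstance, fun _ => ModuleCat.of R W, fun _ => this, ?_⟩
      intro L _ _ _ _ hL hr
      have := hL.1
      exact ⟨(), hW.equiv_of_isRetractOf hr⟩
    · obtain ⟨p, q, hc, hp, hq⟩ := exists_isCompl_finrank_lt k hW
      have := finite_submodule k p
      have := finite_submodule k q
      obtain ⟨ι₁, _, X₁, hX₁, h₁⟩ := ih p (by omega)
      obtain ⟨ι₂, _, X₂, hX₂, h₂⟩ := ih q (by omega)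
      refine ⟨ι₁ ⊕ ι₂, inferInstance, Sum.elim X₁ X₂, ?_, ?_⟩
      · rintro (i | i)
        exacts [hX₁ i, hX₂ i]
      · intro L _ _ _ _ hL hr
        have := hr.trans (isRetractOf_of_equiv (Submodule.prodEquivOfIsCompl p q hc).symm)
        rcases hL.isRetractOf_or this with h | h
        · obtain ⟨i, hi⟩ := h₁ L hL h
          exact ⟨Sum.inl i, hi⟩
        · obtain ⟨i, hi⟩ := h₂ L hL h
          exact ⟨Sum.inr i, hi⟩

/-- The product of a list of members of a family of modules. -/
def listProd {ι : Type} (X : ι → ModuleCat.{0} R) : List ι → ModuleCat.{0} R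
  | [] => ModuleCat.of R PUnit
  | i :: l => ModuleCat.of R (X i × listProd X l)

theorem listProd_append {ι : Type} (X : ι → ModuleCat.{0} R) (l l' : List ι) :
    Nonempty (listProd X (l ++ l') ≃ₗ[R] listProd X l × listProd X l') := by
  induction l with
  | nil => exact ⟨(LinearEquiv.uniqueProd (M := listProd X l') (M₂ := PUnit)).symm⟩
  | cons i l ih =>
    obtain ⟨e⟩ := ih
    exact ⟨((LinearEquiv.refl R (X i)).prodCongr e).trans (LinearEquiv.prodAssoc R _ _ _).symm⟩

theorem listProd_perm {ι : Type} (X : ι → ModuleCat.{0} R) {l l' : List ι} (h : l.Perm l') :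
    Nonempty (listProd X l ≃ₗ[R] listProd X l') := by
  induction h with
  | nil => exact ⟨LinearEquiv.refl R _⟩
  | cons i _ ih =>
    obtain ⟨e⟩ := ih
    exact ⟨(LinearEquiv.refl R (X i)).prodCongr e⟩
  | swap i j l =>
    exact ⟨(LinearEquiv.prodAssoc R _ _ _).symm.trans
      (((LinearEquiv.prodComm R (X j) (X i)).prodCongr (LinearEquiv.refl R (listProd X l))).trans
        (LinearEquiv.prodAssoc R _ _ _))⟩
  | trans _ _ ih ih' =>
    obtain ⟨e⟩ := ih
    obtain ⟨e'⟩ := ih'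
    exact ⟨e.trans e'⟩

theorem exists_equiv_listProd {ι : Type} (X : ι → ModuleCat.{0} R) (d : ℕ) :
    ∀ (M : Type) [AddCommGroup M] [Module R M] [Module k M] [IsScalarTower k R M]
      [Module.Finite k M], Module.finrank k M ≤ d →
    (∀ (L : Type) [AddCommGroup L] [Module R L] [IsNoetherian R L] [IsArtinian R L], Indec R L →
      IsRetractOf R L M → ∃ i, Nonempty (L ≃ₗ[R] X i)) →
    ∃ l : List ι, Nonempty (M ≃ₗ[R] listProd X l) := by
  induction d with
  | zero =>
    intro M _ _ _ _ _ hd _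
    have := Module.finrank_zero_iff.1 (Nat.le_zero.1 hd)
    exact ⟨[], ⟨(0 : M ≃ₗ[R] PUnit)⟩⟩
  | succ d ih =>
    intro M _ _ _ _ _ hd h
    by_cases hle : Module.finrank k M ≤ d
    · exact ih M hle h
    have : Nontrivial M := Module.nontrivial_of_finrank_pos (R := k) (by omega)
    have : IsNoetherian R M := isNoetherian_of_tower k inferInstance
    have : IsArtinian R M := isArtinian_of_tower k inferInstance
    by_cases hM : Indec R M
    · obtain ⟨i, ⟨e⟩⟩ := h M hM (isRetractOf_of_equiv (LinearEquiv.refl R M))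
      exact ⟨[i], ⟨e.trans (LinearEquiv.prodUnique (M := X i) (M₂ := PUnit)).symm⟩⟩
    · obtain ⟨p, q, hc, hp, hq⟩ := exists_isCompl_finrank_lt k hM
      have := finite_submodule k p
      have := finite_submodule k q
      let e := Submodule.prodEquivOfIsCompl p q hc
      obtain ⟨l₁, ⟨e₁⟩⟩ := ih p (by omega) fun L _ _ _ _ hL hr =>
        h L hL ((hr.trans isRetractOf_prod_left).trans (isRetractOf_of_equiv e))
      obtain ⟨l₂, ⟨e₂⟩⟩ := ih q (by omega) fun L _ _ _ _ hL hr =>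
        h L hL ((hr.trans isRetractOf_prod_right).trans (isRetractOf_of_equiv e))
      obtain ⟨e₃⟩ := listProd_append X l₁ l₂
      exact ⟨l₁ ++ l₂, ⟨e.symm.trans ((e₁.prodCongr e₂).trans e₃.symm)⟩⟩

/-- Up to isomorphism, only finitely many modules without repeated summands are summands of powers
of a given finite-dimensional module. -/
theorem finite_basic_retracts (W : Type) [AddCommGroup W] [Module R W] [Module k W]
    [IsScalarTower k R W] [Module.Finite k W] :
    ∃ (κ : Type) (_ : Finite κ) (Y : κ → ModuleCat.{0} R),
      ∀ (M : Type) [AddCommGroup M] [Module R M] [Module k M] [IsScalarTower k R M]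
        [Module.Finite k M] (N : ℕ), IsRetractOf R M (Fin N → W) →
        (∀ L C : ModuleCat.{0} R, Nonempty (M ≃ₗ[R] (L × L × C)) → Subsingleton L) →
        ∃ j, Nonempty (M ≃ₗ[R] Y j) := by
  classical
  obtain ⟨ι, hι, X, hX, h⟩ := finite_indec_retracts (R := R) k _ W le_rfl
  have := Fintype.ofFinite ι
  refine ⟨{l : List ι // l.Nodup}, inferInstance, fun l => listProd X l.1, ?_⟩
  intro M _ _ _ _ _ N hr hb
  obtain ⟨l, ⟨e⟩⟩ := exists_equiv_listProd k X _ M le_rfl fun L _ _ _ _ hL hLM =>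
    h L hL (hL.isRetractOf_of_pi (hLM.trans hr))
  refine ⟨⟨l, ?_⟩, ⟨e⟩⟩
  by_contra hl
  obtain ⟨i, hi⟩ := List.exists_duplicate_iff_not_nodup.2 hl
  rw [List.duplicate_iff_two_le_count] at hi
  have h1 : i ∈ l := List.count_pos_iff.1 (by omega)
  have h2 : i ∈ l.erase i := List.count_pos_iff.1 (by rw [List.count_erase_self]; omega)
  have hp : l.Perm (i :: i :: (l.erase i).erase i) :=
    (List.perm_cons_erase h1).trans ((List.perm_cons_erase h2).cons i)
  obtain ⟨e'⟩ := listProd_perm X hp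
  have := hb (X i) (listProd X ((l.erase i).erase i)) ⟨e.trans e'⟩
  exact not_subsingleton (X i) this

end

end KrullSchmidt

/-! ### τ-rigid modules have vanishing Ext -/

section Presentation

variable {R : Type} [Ring R]

/-- Finitely generated modules over artinian rings have projective covers. -/
theorem exists_projective_cover [IsArtinianRing R] [IsNoetherianRing R] (N : Type)
    [AddCommGroup N] [Module R N] [Module.Finite R N] :
    ∃ (P : ModuleCat.{0} R) (g : P →ₗ[R] N), Module.Projective R P ∧ Module.Finite R P ∧
      Function.Surjective g ∧ SuperfluousSubmodule (LinearMap.ker g) := by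
  obtain ⟨n, π, hπ⟩ := Module.Finite.exists_fin' R N
  let S : Set (Submodule R (Fin n → R)) :=
    {p | Module.Projective R p ∧ Function.Surjective (π ∘ₗ p.subtype)}
  have hS : S.Nonempty := by
    refine ⟨⊤, Module.Projective.of_equiv Submodule.topEquiv.symm, fun y => ?_⟩
    obtain ⟨x, rfl⟩ := hπ y
    exact ⟨⟨x, trivial⟩, rfl⟩
  obtain ⟨p, ⟨hp, hsurj⟩, hmin⟩ := IsArtinian.set_has_minimal S hS
  refine ⟨ModuleCat.of R p, π ∘ₗ p.subtype, hp, inferInstanceAs (Module.Finite R p), hsurj, ?_⟩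
  intro K hK
  have hK' : Function.Surjective ((π ∘ₗ p.subtype) ∘ₗ Submodule.subtype K) := by
    intro y
    obtain ⟨x, rfl⟩ := hsurj y
    have hx : x ∈ LinearMap.ker (π ∘ₗ p.subtype) ⊔ K := by rw [hK]; trivial
    obtain ⟨a, ha, b, hb, rfl⟩ := Submodule.mem_sup.1 hx
    refine ⟨⟨b, hb⟩, ?_⟩
    rw [map_add, LinearMap.mem_ker.1 ha, zero_add]
    rfl
  obtain ⟨h, hh⟩ := Module.projective_lifting_property _ (π ∘ₗ p.subtype) hK'
  let f : Module.End R p := Submodule.subtype K ∘ₗ h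
  have hf : ∀ x, π (f x) = π x := fun x => LinearMap.congr_fun hh x
  have hfn : ∀ (m : ℕ) x, π ((f ^ m) x) = π x := by
    intro m
    induction m with
    | zero => intro x; rfl
    | succ m ih => intro x; rw [pow_succ', Module.End.mul_apply, hf, ih]
  obtain ⟨m, hm, hm1⟩ := ((f.eventually_isCompl_ker_pow_range_pow).and
    (Filter.eventually_ge_atTop 1)).exists
  let p' : Submodule R (Fin n → R) := (LinearMap.range (f ^ m)).map p.subtype
  have hp' : p' ∈ S := by
    constructor
    · have : Module.Projective R (LinearMap.range (f ^ m)) := by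
        exact Module.Projective.of_split (LinearMap.range (f ^ m)).subtype _
          (Submodule.projectionOnto_comp_subtype hm.symm)
      exact Module.Projective.of_equiv
        (Submodule.equivMapOfInjective p.subtype p.injective_subtype (LinearMap.range (f ^ m)))
    · intro y
      obtain ⟨x, rfl⟩ := hsurj y
      exact ⟨⟨_, Submodule.mem_map_of_mem (LinearMap.mem_range_self (f ^ m) x)⟩, hfn m x⟩
  have hle : p' = p :=
    (Submodule.map_subtype_le _ _).eq_of_not_lt (hmin p' hp')
  rw [eq_top_iff]
  rintro ⟨x, hx⟩ -
  rw [← hle] at hx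
  obtain ⟨z, ⟨w, hw⟩, hz⟩ := hx
  have hzx : z = ⟨x, hle ▸ hx⟩ := Subtype.ext hz
  obtain ⟨m, rfl⟩ : ∃ l, m = l + 1 := ⟨m - 1, by omega⟩
  rw [← hzx, ← hw, pow_succ', Module.End.mul_apply]
  exact (h _).2

theorem extVanish_of_presentation {M P₁ P₀ : Type} [AddCommGroup M] [Module R M] [AddCommGroup P₁]
    [Module R P₁] [AddCommGroup P₀] [Module R P₀] [Module.Projective R P₁] [Module.Projective R P₀]
    (f : P₁ →ₗ[R] P₀) (g : P₀ →ₗ[R] M) (hg : Function.Surjective g)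
    (hfg : LinearMap.range f = LinearMap.ker g)
    (hfac : ∀ φ : P₁ →ₗ[R] M, ∃ ψ : P₀ →ₗ[R] M, ψ ∘ₗ f = φ) : ExtVanish R M := by
  intro X Z _ _ _ _ _ π hπ hgen h
  obtain ⟨h₀, hh₀⟩ := Module.projective_lifting_property π (h ∘ₗ g) hπ
  obtain ⟨n, ρ, hρ⟩ := hgen.exists_surjective
  have hgf : ∀ x, g (f x) = 0 := fun x => by
    rw [← LinearMap.mem_ker, ← hfg]; exact LinearMap.mem_range_self f x
  obtain ⟨φ, hφ⟩ := Module.projective_lifting_property ρ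
    ((h₀ ∘ₗ f).codRestrict (LinearMap.ker π) fun x => by
      have := LinearMap.congr_fun hh₀ (f x)
      simp only [LinearMap.comp_apply, hgf, map_zero] at this
      exact this) hρ
  choose ψ hψ using fun i => hfac (LinearMap.proj i ∘ₗ φ)
  let h₁ : P₀ →ₗ[R] X := h₀ - Submodule.subtype _ ∘ₗ ρ ∘ₗ LinearMap.pi ψ
  have hker : LinearMap.ker g ≤ LinearMap.ker h₁ := by
    rw [← hfg]
    rintro _ ⟨x, rfl⟩
    have e1 : LinearMap.pi ψ (f x) = φ x := funext fun i => LinearMap.congr_fun (hψ i) x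
    have e2 := congrArg Subtype.val (LinearMap.congr_fun hφ x)
    simp only [LinearMap.comp_apply] at e2
    simp only [h₁, LinearMap.mem_ker, LinearMap.sub_apply, LinearMap.comp_apply, e1,
      Submodule.subtype_apply, e2]
    exact sub_self _
  let e := g.quotKerEquivOfSurjective hg
  refine ⟨(LinearMap.ker g).liftQ h₁ hker ∘ₗ e.symm.toLinearMap, LinearMap.ext fun y => ?_⟩
  obtain ⟨x, rfl⟩ := hg y
  have e1 : e.symm (g x) = Submodule.Quotient.mk x := by
    rw [LinearEquiv.symm_apply_eq]; rfl
  have e2 := LinearMap.congr_fun hh₀ x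
  simp only [LinearMap.comp_apply] at e2
  simp only [LinearMap.comp_apply, LinearEquiv.coe_coe, e1, Submodule.liftQ_apply, h₁,
    LinearMap.sub_apply, map_sub, e2, Submodule.subtype_apply, LinearMap.map_coe_ker, sub_zero]

end Presentation

section TauRigid

variable (k : Type) [Field k] (B : Type) [Ring B] [Algebra k B]

/-- The homomorphism `x ↦ m · h(x)`. -/
def evalHom {P M : Type} [AddCommGroup P] [Module Bᵐᵒᵖ P] [AddCommGroup M] [Module Bᵐᵒᵖ M]
    (m : M) (h : P →ₗ[Bᵐᵒᵖ] B) : P →ₗ[Bᵐᵒᵖ] M where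
  toFun x := op (h x) • m
  map_add' x y := by rw [map_add, MulOpposite.op_add, add_smul]
  map_smul' r x := by
    rw [map_smul, MulOpposite.smul_eq_mul_unop, op_mul, op_unop, mul_smul, RingHom.id_apply]

theorem IsTauRigid.exists_factor {M P₁ P₀ : ModuleCat.{0} Bᵐᵒᵖ} (hM : IsTauRigid k B M)
    (f : P₁ →ₗ[Bᵐᵒᵖ] P₀) (g : P₀ →ₗ[Bᵐᵒᵖ] M) (hfg : IsMinimalProjPresentation B M P₁ P₀ f g)
    [Module.Finite Bᵐᵒᵖ P₁] (φ : P₁ →ₗ[Bᵐᵒᵖ] M) : ∃ ψ : P₀ →ₗ[Bᵐᵒᵖ] M, ψ ∘ₗ f = φ := by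
  by_contra hφ
  let : Module k M := Module.compHom M (algebraMap k Bᵐᵒᵖ)
  have : IsScalarTower k Bᵐᵒᵖ M := ⟨fun c b m => by
    rw [Algebra.smul_def, mul_smul]; rfl⟩
  let S : Submodule k (P₁ →ₗ[Bᵐᵒᵖ] M) :=
    { carrier := {φ | ∃ ψ : P₀ →ₗ[Bᵐᵒᵖ] M, ψ ∘ₗ f = φ}
      zero_mem' := ⟨0, LinearMap.zero_comp f⟩
      add_mem' := by
        rintro _ _ ⟨ψ, rfl⟩ ⟨ψ', rfl⟩
        exact ⟨ψ + ψ', LinearMap.add_comp f ψ' ψ⟩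
      smul_mem' := by
        rintro c _ ⟨ψ, rfl⟩
        exact ⟨c • ψ, LinearMap.smul_comp c ψ f⟩ }
  obtain ⟨Φ, hΦ, hS⟩ := Submodule.exists_le_ker_of_notMem (p := S) hφ
  let β : M →+ ((P₁ →ₗ[Bᵐᵒᵖ] B) →ₗ[k] k) :=
    { toFun := fun m =>
        { toFun := fun h => Φ (evalHom B m h)
          map_add' := fun h h' => by
            rw [← map_add]
            congr 1
            ext x
            simp [evalHom, add_smul]
          map_smul' := fun c h => by
            rw [RingHom.id_apply, ← map_smul]
            congr 1
            ext x
            simp [evalHom] }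
      map_zero' := by
        ext h
        have : evalHom B (0 : M) h = 0 := by ext; simp [evalHom]
        simp [this]
      map_add' := fun m m' => by
        ext h
        have : evalHom B (m + m') h = evalHom B m h + evalHom B m' h := by ext; simp [evalHom]
        simp [this] }
  have hβ : β = 0 := by
    refine hM P₁ P₀ f g hfg β (fun m b h => ?_) (fun m g₀ => ?_)
    · change Φ _ = Φ _
      congr 1
      ext x
      simp [evalHom, leftMulHom, mul_smul]
    · exact LinearMap.mem_ker.1 (hS ⟨evalHom B m g₀, rfl⟩)
  have := hfg.1
  obtain ⟨n, F, G, -, -, hFG⟩ := Module.Finite.exists_comp_eq_id_of_projective Bᵐᵒᵖ P₁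
  let h (i : Fin n) : P₁ →ₗ[Bᵐᵒᵖ] B :=
    { toFun := fun x => unop (G x i)
      map_add' := fun x y => by simp
      map_smul' := fun r x => by simp [MulOpposite.smul_eq_mul_unop] }
  have key : φ = ∑ i, evalHom B (φ (F (Pi.single i 1))) (h i) := by
    refine LinearMap.ext fun x => ?_
    have hx : F (G x) = x := LinearMap.congr_fun hFG x
    conv_lhs => rw [← hx, ← Finset.univ_sum_single (G x)]
    rw [map_sum, map_sum, LinearMap.sum_apply]
    refine Finset.sum_congr rfl fun i _ => ?_
    have : (Pi.single i (G x i) : Fin n → Bᵐᵒᵖ) = G x i • Pi.single i 1 := by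
      rw [← Pi.single_smul, smul_eq_mul, mul_one]
    rw [this, map_smul, map_smul]
    rfl
  apply hΦ
  rw [key, map_sum]
  refine Finset.sum_eq_zero fun i _ => ?_
  exact LinearMap.congr_fun (DFunLike.congr_fun hβ (φ (F (Pi.single i 1)))) (h i)

theorem IsTauRigid.extVanish [Module.Finite k B] {M : ModuleCat.{0} Bᵐᵒᵖ}
    [Module.Finite Bᵐᵒᵖ M] (hM : IsTauRigid k B M) : ExtVanish Bᵐᵒᵖ M := by
  have : Module.Finite k Bᵐᵒᵖ := Module.Finite.equiv (opLinearEquiv k)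
  have : IsArtinianRing Bᵐᵒᵖ := isArtinian_of_tower k inferInstance
  have : IsNoetherianRing Bᵐᵒᵖ := isNoetherian_of_tower k inferInstance
  obtain ⟨P₀, g, hP₀, _, hg, hgs⟩ := exists_projective_cover (R := Bᵐᵒᵖ) M
  obtain ⟨P₁, f, hP₁, _, hf, hfs⟩ := exists_projective_cover (R := Bᵐᵒᵖ) (LinearMap.ker g)
  have hr : LinearMap.range (Submodule.subtype _ ∘ₗ f) = LinearMap.ker g := by
    rw [LinearMap.range_comp, LinearMap.range_eq_top.2 hf, Submodule.map_top,
        Submodule.range_subtype]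
  have hk : LinearMap.ker (Submodule.subtype _ ∘ₗ f) = LinearMap.ker f := by
    rw [LinearMap.ker_comp, Submodule.ker_subtype]
    rfl
  exact extVanish_of_presentation (Submodule.subtype _ ∘ₗ f) g hg hr
    (hM.exists_factor k B _ g ⟨hP₁, hP₀, hg, hr, hgs, hk ▸ hfs⟩)

end TauRigid

section Restriction

variable {S T : Type} [Ring S] [Ring T]

/-- A module annihilated by the kernel of a surjective ring homomorphism `σ : S → T` is a
`T`-module. -/
@[reducible]
def moduleOfSurjective (σ : S →+* T) (hσ : Function.Surjective σ) (X : Type) [AddCommGroup X]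
    [Module S X] (h : ∀ s, σ s = 0 → ∀ x : X, s • x = 0) : Module T X :=
  Module.compHom X (RingHom.liftOfSurjective σ hσ ⟨Module.toAddMonoidEnd S X, fun s hs =>
    AddMonoidHom.ext fun x => h s hs x⟩)

theorem moduleOfSurjective_smul (σ : S →+* T) (hσ : Function.Surjective σ) (X : Type)
    [AddCommGroup X] [Module S X] (h : ∀ s, σ s = 0 → ∀ x : X, s • x = 0) (s : S) (x : X) :
    letI := moduleOfSurjective σ hσ X h
    σ s • x = s • x :=
  DFunLike.congr_fun (RingHom.liftOfSurjective_comp_apply σ hσ ⟨Module.toAddMonoidEnd S X,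
    fun s hs => AddMonoidHom.ext fun x => h s hs x⟩ s) x

/-- Ext-vanishing is preserved by restriction along a surjective ring homomorphism, provided that
the modules over its codomain are closed under extensions. -/
theorem ExtVanish.of_surjective {N : Type} [AddCommGroup N] [Module T N] [Module S N]
    (hN : ExtVanish T N) (σ : S →+* T) (hσ : Function.Surjective σ)
    (hsmul : ∀ (s : S) (x : N), s • x = σ s • x)
    (hext : ∀ (X : Type) [AddCommGroup X] [Module S X] (K : Submodule S X),
      (∀ s, σ s = 0 → ∀ x ∈ K, s • x = 0) → (∀ s, σ s = 0 → ∀ x : X, s • x ∈ K) →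
      ∀ s, σ s = 0 → ∀ x : X, s • x = 0) : ExtVanish S N := by
  intro X Z _ _ _ _ _ π hπ hgen h
  have hN0 : ∀ s, σ s = 0 → ∀ x : N, s • x = 0 := fun s hs x => by rw [hsmul, hs, zero_smul]
  have hK : ∀ s, σ s = 0 → ∀ x ∈ LinearMap.ker π, s • x = 0 := by
    intro s hs x hx
    obtain ⟨n, ρ, hρ⟩ := hgen.exists_surjective
    obtain ⟨y, hy⟩ := hρ ⟨x, hx⟩
    have e : x = (ρ y : X) := by rw [hy]
    rw [e, ← Submodule.coe_smul, ← map_smul]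
    have : s • y = 0 := funext fun i => hN0 s hs (y i)
    rw [this, map_zero]
    rfl
  let Z' := LinearMap.range h
  let X' := Z'.comap π
  have hZ0 : ∀ s, σ s = 0 → ∀ z : Z', s • z = 0 := by
    rintro s hs ⟨_, n, rfl⟩
    apply Subtype.ext
    rw [Submodule.coe_smul, ← map_smul, hN0 s hs, map_zero]
    rfl
  let π' : X' →ₗ[S] Z' := (π ∘ₗ X'.subtype).codRestrict Z' fun x => x.2
  have hX0 : ∀ s, σ s = 0 → ∀ x : X', s • x = 0 := by
    refine hext X' (LinearMap.ker π') ?_ ?_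
    · intro s hs x hx
      apply Subtype.ext
      exact hK s hs x.1 (congrArg Subtype.val hx)
    · intro s hs x
      rw [LinearMap.mem_ker, map_smul, hZ0 s hs]
  let : Module T Z' := moduleOfSurjective σ hσ Z' hZ0
  let : Module T X' := moduleOfSurjective σ hσ X' hX0
  have hZs : ∀ s (z : Z'), s • z = σ s • z := fun s z => (moduleOfSurjective_smul σ hσ Z' hZ0 s
      z).symm
  have hXs : ∀ s (x : X'), s • x = σ s • x := fun s x => (moduleOfSurjective_smul σ hσ X' hX0 s
      x).symm
  have : IsNoetherian T X' := by
    let : Module S T := Module.compHom T σ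
    have : IsScalarTower S T X' := ⟨fun s t x => by
      rw [hXs, ← mul_smul]; rfl⟩
    exact isNoetherian_of_tower S inferInstance
  let πT : X' →ₗ[T] Z' :=
    { toFun := π'
      map_add' := map_add π'
      map_smul' := fun t x => by
        obtain ⟨s, rfl⟩ := hσ t
        rw [← hXs, map_smul, hZs, RingHom.id_apply] }
  let hT : N →ₗ[T] Z' :=
    { toFun := h.rangeRestrict
      map_add' := map_add _
      map_smul' := fun t x => by
        obtain ⟨s, rfl⟩ := hσ t
        rw [← hsmul, map_smul, hZs, RingHom.id_apply] }
  have hmem : ∀ z : LinearMap.ker π, (z : X) ∈ X' := fun z => by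
    rw [Submodule.mem_comap, LinearMap.map_coe_ker]
    exact zero_mem _
  have hmem' : ∀ z : LinearMap.ker π, (⟨z, hmem z⟩ : X') ∈ LinearMap.ker πT := fun z =>
    Subtype.ext z.2
  have hgT : Gen T N (LinearMap.ker πT) := by
    refine eq_top_iff.2 fun y _ => ?_
    have hy : (⟨y.1.1, congrArg Subtype.val y.2⟩ : LinearMap.ker π) ∈
      (⨆ f : N →ₗ[S] LinearMap.ker π, LinearMap.range f) := by rw [hgen]; trivial
    refine Submodule.iSup_induction _ (motive := fun z : LinearMap.ker π => (⟨⟨z.1, hmem z⟩, hmem'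
        z⟩ : LinearMap.ker πT)
      ∈ (⨆ f : N →ₗ[T] LinearMap.ker πT, LinearMap.range f)) hy ?_ (zero_mem _)
      (fun z z' hz hz' => add_mem hz hz')
    rintro f _ ⟨n, rfl⟩
    let fT : N →ₗ[T] LinearMap.ker πT :=
      { toFun := fun n => ⟨⟨f n, hmem _⟩, hmem' _⟩
        map_add' := fun n n' => by simp
        map_smul' := fun t n => by
          obtain ⟨s, rfl⟩ := hσ t
          apply Subtype.ext
          rw [RingHom.id_apply, Submodule.coe_smul, ← hXs]
          apply Subtype.ext
          simp [← hsmul] }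
    exact Submodule.mem_iSup_of_mem fT ⟨n, rfl⟩
  obtain ⟨u, hu⟩ := hN X' Z' πT (by
    rintro ⟨z, hz⟩
    obtain ⟨x, rfl⟩ := hπ z
    exact ⟨⟨x, hz⟩, rfl⟩) hgT hT
  refine ⟨{ toFun := fun n => (u n : X)
            map_add' := fun n n' => by simp
            map_smul' := fun s n => by simp [hsmul, ← hXs] }, LinearMap.ext fun n => ?_⟩
  exact congrArg Subtype.val (LinearMap.congr_fun hu n)

end Restriction

section SupportTau

variable (k : Type) [Field k] (A : Type) [Ring A] [Algebra k A]

theorem IdemQuot.mk_surjective (e : A) : Function.Surjective (IdemQuot.mk A e) :=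
  RingCon.mk'_surjective _

theorem IdemQuot.mk_eq_zero_iff (e a : A) :
    IdemQuot.mk A e a = 0 ↔ a ∈ TwoSidedIdeal.span {e} := by
  rw [TwoSidedIdeal.mem_iff]
  exact RingCon.eq _

instance [Module.Finite k A] (e : A) : Module.Finite k (IdemQuot A e) :=
  Module.Finite.of_surjective
    ({ toFun := IdemQuot.mk A e
       map_add' := map_add _
       map_smul' := fun c a => by
        rw [Algebra.smul_def, map_mul, RingHom.id_apply, Algebra.smul_def]; rfl } :
      A →ₗ[k] IdemQuot A e) (IdemQuot.mk_surjective A e)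

theorem smul_eq_zero_of_mem_span {X : Type} [AddCommGroup X] [Module Aᵐᵒᵖ X] {e : A}
    (K : Submodule Aᵐᵒᵖ X) (h : ∀ x : X, op e • x ∈ K) {a : A}
    (ha : a ∈ TwoSidedIdeal.span {e}) (x : X) : op a • x ∈ K := by
  let I : TwoSidedIdeal A := TwoSidedIdeal.mk' {a | ∀ x : X, op a • x ∈ K}
    (fun x => by simp)
    (fun ha hb x => by rw [MulOpposite.op_add, add_smul]; exact add_mem (ha x) (hb x))
    (fun ha x => by rw [MulOpposite.op_neg, neg_smul]; exact neg_mem (ha x))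
    (fun ha x => by rw [op_mul, mul_smul]; exact ha _)
    (fun ha x => by rw [op_mul, mul_smul]; exact K.smul_mem _ (ha _))
  have hI : TwoSidedIdeal.span {e} ≤ I := by
    rw [TwoSidedIdeal.span_le]
    rintro _ rfl
    exact (TwoSidedIdeal.mem_mk' _ _ _ _ _ _ _).2 h
  exact (TwoSidedIdeal.mem_mk' _ _ _ _ _ _ _).1 (hI ha) x

theorem IsSupportTauTilting.extVanish [Module.Finite k A] {M : ModuleCat.{0} Aᵐᵒᵖ}
    (hM : IsSupportTauTilting k A M) : Module.Finite Aᵐᵒᵖ M ∧ ExtVanish Aᵐᵒᵖ M := by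
  obtain ⟨e, he, N, ⟨hfin, hrig, -⟩, hMN⟩ := hM
  let σ : Aᵐᵒᵖ →+* (IdemQuot A e)ᵐᵒᵖ := RingHom.op (IdemQuot.mk A e)
  let : Module Aᵐᵒᵖ N := Module.compHom N σ
  obtain ⟨φ⟩ := hMN
  have hσ : Function.Surjective σ := fun b => by
    obtain ⟨a, ha⟩ := IdemQuot.mk_surjective A e b.unop
    exact ⟨op a, congrArg op ha⟩
  have hσ0 : ∀ s, σ s = 0 ↔ s.unop ∈ TwoSidedIdeal.span {e} := fun s => by
    rw [← IdemQuot.mk_eq_zero_iff]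
    exact (MulOpposite.op_eq_zero_iff _)
  constructor
  · have : Module.Finite Aᵐᵒᵖ N := by
      obtain ⟨t, ht⟩ := hfin
      refine ⟨⟨t, ?_⟩⟩
      rw [eq_top_iff]
      intro x _
      have hx : x ∈ Submodule.span (IdemQuot A e)ᵐᵒᵖ (t : Set N) := by rw [ht]; trivial
      refine Submodule.span_induction (fun x hx => Submodule.subset_span hx) (zero_mem _)
        (fun x y _ _ hx hy => add_mem hx hy) (fun b x _ hx => ?_) hx
      obtain ⟨s, rfl⟩ := hσ b
      exact Submodule.smul_mem _ s hx
    exact Module.Finite.equiv φ.symm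
  · have h := (hrig.extVanish k (IdemQuot A e)).of_surjective σ hσ (fun s x => rfl) (by
      intro X _ _ K hK hX s hs x
      have he0 : ∀ x : X, op e • x = 0 := fun x => by
        have h1 : σ (op e) = 0 := (hσ0 _).2 (TwoSidedIdeal.subset_span rfl)
        rw [← hK _ h1 _ (hX _ h1 x), ← mul_smul, ← op_mul, he.eq]
      exact (Submodule.mem_bot Aᵐᵒᵖ).1
        (smul_eq_zero_of_mem_span A ⊥ (fun x => (Submodule.mem_bot _).2 (he0 x)) ((hσ0 s).1 hs) x))
    exact h.congr φ.symm

end SupportTau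

/-! ### Finitely many bricks imply τ-tilting finiteness -/

section BrickFinite

theorem Module.compHom_isScalarTower (k : Type) [Field k] {R : Type} [Ring R] [Algebra k R] (M :
    Type) [AddCommGroup M] [Module R M] :
    letI : Module k M := Module.compHom M (algebraMap k R)
    IsScalarTower k R M :=
  letI : Module k M := Module.compHom M (algebraMap k R)
  ⟨fun c r m => by rw [Algebra.smul_def, mul_smul]; rfl⟩

theorem finite_basic_extVanish_of_finite_bricks (k : Type) [Field k] {R : Type} [Ring R]
    [Algebra k R] [Module.Finite k R] {ι : Type} [Finite ι] (X : ι → ModuleCat.{0} R)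
    (hX : ∀ (Y : Type) [AddCommGroup Y] [Module R Y] [Module.Finite R Y], IsBrick R Y →
      ∃ i, Nonempty (Y ≃ₗ[R] X i)) :
    ∃ (n : ℕ) (Y : Fin n → ModuleCat.{0} R), ∀ M : ModuleCat.{0} R, Module.Finite R M →
      ExtVanish R M →
      (∀ L C : ModuleCat.{0} R, Nonempty (M ≃ₗ[R] (L × L × C)) → Subsingleton L) →
      ∃ j, Nonempty (M ≃ₗ[R] Y j) := by
  have : IsArtinianRing R := isArtinian_of_tower k inferInstance
  have : IsNoetherianRing R := isNoetherian_of_tower k inferInstance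
  let br (M : ModuleCat.{0} R) : Set ι := {i | Gen R M (X i)}
  have hbr : ∀ U M : ModuleCat.{0} R, ExtVanish R U → Module.Finite R M → br M = br U →
      Gen R U M := by
    intro U M hU hM h
    by_contra hg
    obtain ⟨Q, Y, hY, hMY, hUY⟩ := exists_brick_of_not_gen hU hg
    obtain ⟨i, ⟨e⟩⟩ := hX Y hY
    have hi : i ∈ br U := h ▸ hMY.congr e
    exact hUY (Gen.congr hi e.symm)
  have key : ∀ s : Set ι, ∃ (κ : Type) (_ : Finite κ) (Y : κ → ModuleCat.{0} R),
      ∀ M : ModuleCat.{0} R, Module.Finite R M → ExtVanish R M →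
      (∀ L C : ModuleCat.{0} R, Nonempty (M ≃ₗ[R] (L × L × C)) → Subsingleton L) → br M = s →
      ∃ j, Nonempty (M ≃ₗ[R] Y j) := by
    intro s
    by_cases hs : ∃ U : ModuleCat.{0} R, Module.Finite R U ∧ ExtVanish R U ∧ br U = s
    · obtain ⟨U, hUf, hU, rfl⟩ := hs
      let : Module k U := Module.compHom U (algebraMap k R)
      have : IsScalarTower k R U := Module.compHom_isScalarTower k U
      have : Module.Finite k U := Module.Finite.trans R U
      obtain ⟨κ, hκ, Y, hY⟩ := finite_basic_retracts k (R := R) (GenCover k R U)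
      refine ⟨κ, hκ, Y, fun M hMf hM hb h => ?_⟩
      let : Module k M := Module.compHom M (algebraMap k R)
      have : IsScalarTower k R M := Module.compHom_isScalarTower k M
      have : Module.Finite k M := Module.Finite.trans R M
      obtain ⟨N, hN⟩ := isRetractOf_genCover k hM (hbr U M hU hMf h) (hbr M U hM hUf h.symm)
      exact hY M N hN hb
    · exact ⟨Empty, inferInstance, Empty.rec, fun M hMf hM _ h => absurd ⟨M, hMf, hM, h⟩ hs⟩
  choose κ hκ Y hY using key
  obtain ⟨n, ⟨e⟩⟩ := Finite.exists_equiv_fin (Σ s, κ s)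
  let Y' (x : Σ s, κ s) := Y x.1 x.2
  refine ⟨n, Y' ∘ e.symm, fun M hMf hM hb => ?_⟩
  obtain ⟨j, hj⟩ := hY (br M) M hMf hM hb rfl
  exact ⟨e ⟨_, j⟩, by rw [Function.comp_apply, e.symm_apply_apply]; exact hj⟩

theorem tauTiltingFinite_of_finite_bricks (k : Type) [Field k] (A : Type) [Ring A] [Algebra k A]
    [Module.Finite k A]
    {ι : Type} [Finite ι] (X : ι → ModuleCat.{0} Aᵐᵒᵖ)
    (hX : ∀ (Y : Type) [AddCommGroup Y] [Module Aᵐᵒᵖ Y] [Module.Finite Aᵐᵒᵖ Y], IsBrick Aᵐᵒᵖ Y →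
      ∃ i, Nonempty (Y ≃ₗ[Aᵐᵒᵖ] X i)) : TauTiltingFinite k A := by
  have : Module.Finite k Aᵐᵒᵖ := Module.Finite.equiv (opLinearEquiv k)
  obtain ⟨n, Y, hY⟩ := finite_basic_extVanish_of_finite_bricks k X hX
  exact ⟨n, Y, fun M hM hb => hY M (hM.extVanish k A).1 (hM.extVanish k A).2 hb⟩

end BrickFinite

/-! ### Bricks over quivers with one branching vertex and a unique continuation of every arrow -/

section Branch

/-- A quiver in which each arrow `x` has a distinguished continuation `σ x`, and in which only the
vertex `o` may be the source of more than one arrow, and then of at most two. -/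
structure BranchQuiver (V E : Type) where
  s : E → V
  t : E → V
  σ : Equiv.Perm E
  o : V
  tgt_eq : ∀ x, t x = s (σ x)
  eq_of_src : ∀ x y, s x = s y → s x ≠ o → x = y
  two_le : ∀ x y z, s x = s y → s x = s z → x = y ∨ x = z ∨ y = z

/-- The opposite quiver. -/
def BranchQuiver.dual {V E : Type} (D : BranchQuiver V E) : BranchQuiver V E where
  s := D.t
  t := D.s
  σ := D.σ.symm
  o := D.o
  tgt_eq x := by rw [D.tgt_eq, Equiv.apply_symm_apply]
  eq_of_src x y h ho := by
    simp only [D.tgt_eq] at h ho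
    exact D.σ.injective (D.eq_of_src _ _ h ho)
  two_le x y z h h' := by
    simp only [D.tgt_eq] at h h'
    simpa using D.two_le _ _ _ h h'

variable {V E : Type} [Fintype V] [DecidableEq V]

/-- A representation in which the composite of two arrows vanishes unless the second is the
distinguished continuation of the first. -/
structure BranchRep (D : BranchQuiver V E) (k : Type) [Field k] (Y : Type) [AddCommGroup Y]
    [Module k Y] where
  ε : V → Module.End k Y
  ρ : E → Module.End k Y
  ε_mul : ∀ u v, ε u * ε v = if u = v then ε u else 0
  sum_ε : ∑ v, ε v = 1
  ρ_ε : ∀ x, ρ x * ε (D.s x) = ρ x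
  ε_ρ : ∀ x, ε (D.t x) * ρ x = ρ x
  ρ_ρ : ∀ x y, y ≠ D.σ x → ρ y * ρ x = 0

namespace BranchRep

variable {D : BranchQuiver V E} {k : Type} [Field k] {Y Y' : Type} [AddCommGroup Y] [Module k Y]
  [AddCommGroup Y'] [Module k Y'] (r : BranchRep D k Y) (r' : BranchRep D k Y')

/-- The action of the path of length `n` which starts with the arrow `x`. -/
def W : E → ℕ → Module.End k Y
  | x, 0 => r.ε (D.s x)
  | x, n + 1 => W (D.σ x) n * r.ρ x

theorem W_zero (x : E) : r.W x 0 = r.ε (D.s x) := rfl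

theorem W_succ (x : E) (n : ℕ) : r.W x (n + 1) = r.W (D.σ x) n * r.ρ x := rfl

theorem W_one (x : E) : r.W x 1 = r.ρ x := by
  rw [W_succ, W_zero, ← D.tgt_eq, r.ε_ρ]

theorem ε_idem (v : V) : r.ε v * r.ε v = r.ε v := by rw [r.ε_mul, if_pos rfl]

theorem W_ε (x : E) (n : ℕ) : r.W x n * r.ε (D.s x) = r.W x n := by
  cases n with
  | zero => exact r.ε_idem _
  | succ n => rw [W_succ, mul_assoc, r.ρ_ε]

theorem W_succ' (x : E) (n : ℕ) : r.W x (n + 1) = r.ρ ((D.σ ^ n) x) * r.W x n := by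
  induction n generalizing x with
  | zero => rw [W_one, W_zero]; exact (r.ρ_ε x).symm
  | succ n ih => rw [W_succ, ih, mul_assoc, ← W_succ, pow_succ, Equiv.Perm.mul_apply]

theorem ε_W (x : E) (n : ℕ) : r.ε (D.s ((D.σ ^ n) x)) * r.W x n = r.W x n := by
  cases n with
  | zero => exact r.ε_idem _
  | succ n =>
    rw [W_succ', ← mul_assoc, pow_succ', Equiv.Perm.mul_apply, ← D.tgt_eq, r.ε_ρ]

theorem ρ_W (x z : E) (n : ℕ) (hz : z ≠ (D.σ ^ (n + 1)) x) : r.ρ z * r.W x (n + 1) = 0 := by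
  rw [W_succ', ← mul_assoc, r.ρ_ρ _ _ (by rwa [pow_succ', Equiv.Perm.mul_apply] at hz), zero_mul]

theorem W_ρ (x z : E) (n : ℕ) (hz : x ≠ D.σ z) : r.W x (n + 1) * r.ρ z = 0 := by
  rw [W_succ, mul_assoc, r.ρ_ρ _ _ hz, mul_zero]

theorem W_eq_zero_of_le {x : E} {n m : ℕ} (h : r.W x n = 0) (hnm : n ≤ m) : r.W x m = 0 := by
  induction m, hnm using Nat.le_induction with
  | base => exact h
  | succ m _ ih => rw [W_succ', ih, mul_zero]

theorem ε_mul_W (u : V) (x : E) (n : ℕ) :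
    r.ε u * r.W x n = if u = D.s ((D.σ ^ n) x) then r.W x n else 0 := by
  rw [← r.ε_W, ← mul_assoc, r.ε_mul]
  split_ifs with h
  · rw [h]
  · rw [zero_mul]

theorem W_mul_ε (u : V) (x : E) (n : ℕ) :
    r.W x n * r.ε u = if u = D.s x then r.W x n else 0 := by
  rw [← r.W_ε, mul_assoc, r.ε_mul]
  by_cases h : u = D.s x
  · rw [if_pos h.symm, if_pos h]
  · rw [if_neg (Ne.symm h), if_neg h, mul_zero]

/-- A homomorphism of representations. -/
def IsHom (φ : Y →ₗ[k] Y') : Prop :=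
  (∀ v, φ ∘ₗ r.ε v = r'.ε v ∘ₗ φ) ∧ ∀ x, φ ∘ₗ r.ρ x = r'.ρ x ∘ₗ φ

/-- A nonzero representation all of whose nonzero endomorphisms are bijective. -/
def IsRepBrick : Prop :=
  Nontrivial Y ∧ ∀ φ : Y →ₗ[k] Y, r.IsHom r φ → φ ≠ 0 → Function.Bijective φ

/-- The representation has a vector `y` and a functional `τ` of a prescribed type: `y` lies at the
vertex `v` and is annihilated by exactly the paths longer than `n`, and `τ` factors through the
    paths
of lengths `n`. -/
def HasType (v : V) (n : E → ℕ) : Prop :=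
  ∃ (y : Y) (τ : Y →ₗ[k] k) (f : E → Y →ₗ[k] k),
    r.ε v y = y ∧ τ ∘ₗ r.ε v = τ ∧ τ y = 1 ∧ (∀ z, τ ∘ₗ r.ρ z = 0) ∧
    (∀ x, r.W x (n x + 1) y = 0) ∧
    ∀ x, n x ≠ 0 → f x ∘ₗ r.W x (n x) = τ ∧
      ∀ z, D.σ z ≠ (D.σ ^ n x) x → f x ∘ₗ r.ρ z = 0

variable {r r'}

theorem IsHom.comp {Y'' : Type} [AddCommGroup Y''] [Module k Y''] {r'' : BranchRep D k Y''}
    {φ : Y →ₗ[k] Y'} {ψ : Y' →ₗ[k] Y''} (hψ : r'.IsHom r'' ψ) (hφ : r.IsHom r' φ) :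
    r.IsHom r'' (ψ ∘ₗ φ) :=
  ⟨fun v => by rw [LinearMap.comp_assoc, hφ.1, ← LinearMap.comp_assoc, hψ.1, LinearMap.comp_assoc],
    fun v => by rw [LinearMap.comp_assoc, hφ.2, ← LinearMap.comp_assoc, hψ.2, LinearMap.comp_assoc]⟩

theorem IsRepBrick.bijective (hr : r.IsRepBrick) (hr' : r'.IsRepBrick) {φ : Y →ₗ[k] Y'}
    {ψ : Y' →ₗ[k] Y} (hφ : r.IsHom r' φ) (hψ : r'.IsHom r ψ) (h : ψ ∘ₗ φ ≠ 0) (h' : φ ∘ₗ ψ ≠ 0) :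
    Function.Bijective φ :=
  ⟨Function.Injective.of_comp (hr.2 _ (hψ.comp hφ) h).1,
    Function.Surjective.of_comp (hr'.2 _ (hφ.comp hψ) h').2⟩

/-- The canonical homomorphism from a representation with a functional of a given type to a
representation with a vector of the same type. -/
theorem HasType.exists_hom [Fintype E] {v : V} {n : E → ℕ} (y : Y') (hy : r'.ε v y = y)
    (hW : ∀ x, r'.W x (n x + 1) y = 0) (τ : Y →ₗ[k] k) (f : E → Y →ₗ[k] k)
    (hτ : τ ∘ₗ r.ε v = τ) (hτρ : ∀ z, τ ∘ₗ r.ρ z = 0)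
    (hf : ∀ x, n x ≠ 0 → f x ∘ₗ r.W x (n x) = τ ∧
      ∀ z, D.σ z ≠ (D.σ ^ n x) x → f x ∘ₗ r.ρ z = 0) :
    ∃ φ : Y →ₗ[k] Y', r.IsHom r' φ ∧
      ∀ τ' : Y' →ₗ[k] k, τ' y = 1 → (∀ z, τ' ∘ₗ r'.ρ z = 0) → τ' ∘ₗ φ = τ := by
  classical
  let c (x : E) (i : ℕ) : Y →ₗ[k] k := f x ∘ₗ r.W ((D.σ ^ i) x) (n x - i)
  let φ : Y →ₗ[k] Y' := τ.smulRight y +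
    ∑ x, ∑ i ∈ Finset.range (n x), (c x (i + 1)).smulRight (r'.W x (i + 1) y)
  have hφ : ∀ w, φ w = τ w • y +
      ∑ x, ∑ i ∈ Finset.range (n x), c x (i + 1) w • r'.W x (i + 1) y := by
    intro w
    simp [φ, LinearMap.sum_apply]
  refine ⟨φ, ⟨fun u => LinearMap.ext fun w => ?_, fun z => LinearMap.ext fun w => ?_⟩, ?_⟩
  · simp only [LinearMap.comp_apply, hφ, map_add, map_sum, map_smul]
    congr 1
    · have h1 : τ (r.ε u w) = if v = u then τ w else 0 := by
        rw [← hτ, LinearMap.comp_apply, ← Module.End.mul_apply, r.ε_mul]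
        split_ifs <;> simp
      have h2 : r'.ε u y = if v = u then y else 0 := by
        conv_lhs => rw [← hy]
        rw [← Module.End.mul_apply, r'.ε_mul]
        by_cases h : u = v
        · subst h; simp [hy]
        · rw [if_neg h, if_neg (Ne.symm h), LinearMap.zero_apply]
      rw [h1, h2]
      split_ifs <;> simp
    · refine Finset.sum_congr rfl fun x _ => Finset.sum_congr rfl fun i _ => ?_
      have h1 : c x (i + 1) (r.ε u w) = if u = D.s ((D.σ ^ (i + 1)) x) then c x (i + 1) w else 0 := by
        simp only [c, LinearMap.comp_apply]
        rw [← Module.End.mul_apply, r.W_mul_ε]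
        split_ifs <;> simp
      rw [h1, ← Module.End.mul_apply, r'.ε_mul_W]
      split_ifs <;> simp
  · simp only [LinearMap.comp_apply, hφ, map_add, map_sum, map_smul]
    have h0 : τ (r.ρ z w) = 0 := LinearMap.congr_fun (hτρ z) w
    have key : ∀ x, ∑ i ∈ Finset.range (n x), c x (i + 1) (r.ρ z w) • r'.W x (i + 1) y =
        (if x = z then τ w • r'.ρ z y else 0) +
          ∑ i ∈ Finset.range (n x), c x (i + 1) w • r'.ρ z (r'.W x (i + 1) y) := by
      intro x
      by_cases hn : n x = 0
      · rw [hn]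
        have := hW x
        rw [hn, zero_add, W_one] at this
        split_ifs with hxz
        · subst hxz
          simp [this]
        · simp
      obtain ⟨hfτ, hfρ⟩ := hf x hn
      let b (i : ℕ) : Y' := if z = (D.σ ^ i) x then c x i w • r'.W x (i + 1) y else 0
      have hb0 : b 0 = if x = z then τ w • r'.ρ z y else 0 := by
        have : c x 0 w = τ w := LinearMap.congr_fun hfτ w
        simp only [b, pow_zero, Equiv.Perm.one_apply, this, zero_add, W_one, eq_comm (a := z)]
        split_ifs with h
        · rw [h]
        · rfl
      have hbn : b (n x) = 0 := by
        simp only [b, hW x, smul_zero, ite_self]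
      have hbs : ∀ i, c x (i + 1) w • r'.ρ z (r'.W x (i + 1) y) = b (i + 1) := by
        intro i
        simp only [b]
        split_ifs with h
        · rw [W_succ' _ _ (i + 1), h, Module.End.mul_apply]
        · rw [← Module.End.mul_apply, ρ_W _ _ _ _ h, LinearMap.zero_apply, smul_zero]
      have hbi : ∀ i ∈ Finset.range (n x), c x (i + 1) (r.ρ z w) • r'.W x (i + 1) y = b i := by
        intro i hi
        rw [Finset.mem_range] at hi
        simp only [b]
        have hσ : (D.σ ^ (i + 1)) x = D.σ ((D.σ ^ i) x) := by
          rw [pow_succ', Equiv.Perm.mul_apply]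
        split_ifs with h
        · congr 1
          simp only [c, LinearMap.comp_apply]
          rw [← Module.End.mul_apply, hσ, ← h, ← W_succ]
          congr 3
          omega
        · suffices c x (i + 1) (r.ρ z w) = 0 by rw [this, zero_smul]
          simp only [c, LinearMap.comp_apply]
          rw [← Module.End.mul_apply]
          obtain ⟨m, hm⟩ : ∃ m, n x = i + 1 + m := ⟨n x - (i + 1), by omega⟩
          have hne : (D.σ ^ (i + 1)) x ≠ D.σ z := by
            rw [hσ]
            exact fun h' => h (D.σ.injective h'.symm)
          cases m with
          | succ m =>
            have : n x - (i + 1) = m + 1 := by omega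
            rw [this, W_ρ _ _ _ _ hne, LinearMap.zero_apply, map_zero]
          | zero =>
            have hi' : i + 1 = n x := by omega
            rw [hi'] at hne ⊢
            rw [Nat.sub_self, W_zero, ← r.ε_ρ, ← mul_assoc, r.ε_mul]
            split_ifs with h'
            · rw [h', r.ε_ρ]
              exact LinearMap.congr_fun (hfρ z hne.symm) w
            · simp
      rw [Finset.sum_congr rfl hbi, Finset.sum_congr rfl fun i _ => hbs i, ← hb0, add_comm,
        ← Finset.sum_range_succ', Finset.sum_range_succ, hbn, add_zero]
    rw [h0, zero_smul, zero_add, Finset.sum_congr rfl fun x _ => key x, Finset.sum_add_distrib]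
    simp
  · intro τ' hy' hρ'
    refine LinearMap.ext fun w => ?_
    have : ∀ x i, τ' (r'.W x (i + 1) y) = 0 := fun x i => by
      rw [W_succ', Module.End.mul_apply]
      exact LinearMap.congr_fun (hρ' _) _
    simp only [LinearMap.comp_apply, hφ, map_add, map_sum, map_smul, this, hy']
    simp

theorem HasType.exists_homs [Fintype E] {v : V} {n : E → ℕ} (h : r.HasType v n) (h' : r'.HasType v
    n) :
    ∃ (φ : Y →ₗ[k] Y') (ψ : Y' →ₗ[k] Y), r.IsHom r' φ ∧ r'.IsHom r ψ ∧ ψ ∘ₗ φ ≠ 0 ∧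
      φ ∘ₗ ψ ≠ 0 := by
  obtain ⟨y, τ, f, hy, hτ, hτy, hτρ, hW, hf⟩ := h
  obtain ⟨y', τ', f', hy', hτ', hτy', hτρ', hW', hf'⟩ := h'
  obtain ⟨φ, hφ, hφτ⟩ := exists_hom (r := r) (r' := r') y' hy' hW' τ f hτ hτρ hf
  obtain ⟨ψ, hψ, hψτ⟩ := exists_hom (r := r') (r' := r) y hy hW τ' f' hτ' hτρ' hf'
  have h1 := hφτ τ' hτy' hτρ'
  have h2 := hψτ τ hτy hτρ
  refine ⟨φ, ψ, hφ, hψ, fun h => ?_, fun h => ?_⟩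
  · have : τ ∘ₗ ψ ∘ₗ φ = τ := by rw [← LinearMap.comp_assoc, h2, h1]
    rw [h, LinearMap.comp_zero] at this
    rw [← this] at hτy
    simp at hτy
  · have : τ' ∘ₗ φ ∘ₗ ψ = τ' := by rw [← LinearMap.comp_assoc, h1, h2]
    rw [h, LinearMap.comp_zero] at this
    rw [← this] at hτy'
    simp at hτy'

theorem ρ_eq_zero
    (h : ∀ x y, r.ε (D.s x) y = y → ∃ w, r.ρ x (y - r.ρ (D.σ.symm x) w) = 0) (N : ℕ)
    (hN : ∀ x, r.W x (N + 1) = 0) (x : E) : r.ρ x = 0 := by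
  induction N with
  | zero => rw [← W_one]; exact hN x
  | succ N ih =>
    refine ih fun x => LinearMap.ext fun y => ?_
    obtain ⟨w, hw⟩ := h x (r.ε (D.s x) y) (by rw [← Module.End.mul_apply, ε_idem])
    rw [map_sub, sub_eq_zero] at hw
    rw [← W_ε, Module.End.mul_apply, W_succ, Module.End.mul_apply, hw, ← Module.End.mul_apply,
      ← W_succ, ← Module.End.mul_apply]
    have := r.W_succ (D.σ.symm x) (N + 1)
    rw [Equiv.apply_symm_apply] at this
    rw [← this, hN, LinearMap.zero_apply, LinearMap.zero_apply]

/-- No vector at the branching vertex is annihilated by all arrows. -/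
def NoSocle (r : BranchRep D k Y) : Prop :=
  ∀ y, r.ε D.o y = y → (∀ z, r.ρ z y = 0) → y = 0

theorem NoSocle.hasType_of_ker_le (hs : r.NoSocle) {v : V} {n : E → ℕ} (y : Y) (τ : Y →ₗ[k] k)
    (hy : r.ε v y = y) (hτ : τ ∘ₗ r.ε v = τ) (hτy : τ y = 1) (hτρ : ∀ z, τ ∘ₗ r.ρ z = 0)
    (hW : ∀ x, r.W x (n x + 1) y = 0)
    (hker : ∀ x, n x ≠ 0 → LinearMap.ker (r.W x (n x)) ≤ LinearMap.ker τ) : r.HasType v n := by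
  have key : ∀ x, ∃ f : Y →ₗ[k] k, n x ≠ 0 → f ∘ₗ r.W x (n x) = τ ∧
      ∀ z, D.σ z ≠ (D.σ ^ n x) x → f ∘ₗ r.ρ z = 0 := by
    intro x
    by_cases hn : n x = 0
    · exact ⟨0, fun h => absurd hn h⟩
    obtain ⟨m, hm⟩ := Nat.exists_eq_succ_of_ne_zero hn
    have hmem : τ ∈ (LinearMap.ker (r.W x (n x))).dualAnnihilator := by
      rw [Submodule.mem_dualAnnihilator]
      exact fun w hw => hker x hn hw
    rw [← LinearMap.range_dualMap_eq_dualAnnihilator_ker] at hmem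
    obtain ⟨g, hg⟩ := hmem
    have hg' : g ∘ₗ r.W x (n x) = τ := hg
    let u := D.s ((D.σ ^ n x) x)
    have hne : r.W x (n x) y ≠ 0 := by
      intro h
      have := LinearMap.congr_fun hg' y
      rw [LinearMap.comp_apply, h, map_zero, hτy] at this
      exact zero_ne_one this
    have hu : u ≠ D.o := by
      intro hu
      refine hne (hs _ ?_ fun z => ?_)
      · rw [← hu, ← Module.End.mul_apply, ε_W]
      · by_cases hz : z = (D.σ ^ n x) x
        · rw [hz, ← Module.End.mul_apply, ← W_succ', hW]
        · rw [← Module.End.mul_apply, hm]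
          rw [hm] at hz
          rw [ρ_W _ _ _ _ hz, LinearMap.zero_apply]
    refine ⟨g ∘ₗ r.ε u, fun _ => ⟨?_, fun z hz => ?_⟩⟩
    · rw [LinearMap.comp_assoc, ← Module.End.mul_eq_comp, ε_W, hg']
    · rw [LinearMap.comp_assoc, ← Module.End.mul_eq_comp, ← r.ε_ρ, ← mul_assoc, r.ε_mul, if_neg,
        zero_mul, LinearMap.comp_zero]
      intro h
      rw [D.tgt_eq] at h
      exact hz (D.eq_of_src _ _ h hu).symm
  choose f hf using key
  exact ⟨y, τ, f, hy, hτ, hτy, hτρ, hW, hf⟩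

theorem NoSocle.exists_hasType [Nontrivial Y] (hs : r.NoSocle) {N : ℕ} (hN : ∀ x, r.W x N = 0) :
    ∃ v n, (∀ x, n x ≤ N) ∧ r.HasType v n := by
  classical
  have hN' : ∀ x, r.W x (N + 1) = 0 := fun x => r.W_eq_zero_of_le (hN x) N.le_succ
  let P (x : E) (n : ℕ) : Prop :=
    ∀ y, r.ε (D.s x) y = y → ∃ w, r.W x (n + 1) (y - r.ρ (D.σ.symm x) w) = 0
  by_cases hP : ∀ x, P x 0
  · have hρ : ∀ x, r.ρ x = 0 :=
      r.ρ_eq_zero (fun x y hy => by simpa only [zero_add, W_one] using hP x y hy) N hN'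
    obtain ⟨v, hv⟩ : ∃ v, r.ε v ≠ 0 := by
      by_contra! h
      have := r.sum_ε
      simp only [h, Finset.sum_const_zero] at this
      exact zero_ne_one this
    obtain ⟨w, hw⟩ : ∃ w, r.ε v w ≠ 0 := by
      by_contra! h
      exact hv (LinearMap.ext h)
    obtain ⟨g, hg⟩ : ∃ g : Module.Dual k Y, g (r.ε v w) ≠ 0 := by
      by_contra! h
      exact hw ((Module.forall_dual_apply_eq_zero_iff k _).mp h)
    refine ⟨v, fun _ => 0, fun _ => Nat.zero_le _, r.ε v w, (g (r.ε v w))⁻¹ • (g ∘ₗ r.ε v),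
      fun _ => 0, ?_, ?_, ?_, fun z => ?_, fun x => ?_, fun x hx => absurd rfl hx⟩
    · rw [← Module.End.mul_apply, ε_idem]
    · rw [LinearMap.smul_comp, LinearMap.comp_assoc, ← Module.End.mul_eq_comp, ε_idem]
    · rw [LinearMap.smul_apply, LinearMap.comp_apply, ← Module.End.mul_apply, ε_idem, smul_eq_mul,
        inv_mul_cancel₀ hg]
    · rw [hρ, LinearMap.comp_zero]
    · rw [zero_add, W_one, hρ, LinearMap.zero_apply]
  push Not at hP
  obtain ⟨x, hx⟩ := hP
  have hPN : ∃ n, P x n := ⟨N, fun y _ => ⟨0, by rw [hN', LinearMap.zero_apply]⟩⟩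
  obtain ⟨n, hn, hPn, hPn'⟩ : ∃ n, n + 1 ≤ N ∧ P x (n + 1) ∧ ¬ P x n := by
    have h0 : Nat.find hPN ≠ 0 := fun h => hx (h ▸ Nat.find_spec hPN)
    have hle : Nat.find hPN ≤ N :=
      Nat.find_min' _ fun y _ => ⟨0, by rw [hN', LinearMap.zero_apply]⟩
    have hspec := Nat.find_spec hPN
    refine ⟨Nat.find hPN - 1, by omega, ?_, Nat.find_min hPN (by omega)⟩
    rwa [Nat.sub_add_cancel (Nat.one_le_iff_ne_zero.mpr h0)]
  have hερ : ∀ w, r.ε (D.s x) (r.ρ (D.σ.symm x) w) = r.ρ (D.σ.symm x) w := by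
    intro w
    have := r.ε_ρ (D.σ.symm x)
    rw [D.tgt_eq, Equiv.apply_symm_apply] at this
    rw [← Module.End.mul_apply, this]
  let Q (y : Y) : Prop := r.ε (D.s x) y = y ∧ r.W x (n + 2) y = 0 ∧
    ∀ w, r.W x (n + 1) (y - r.ρ (D.σ.symm x) w) ≠ 0
  have hQ : ∃ y, Q y := by
    simp only [P] at hPn'
    push Not at hPn'
    obtain ⟨y, hy, hyw⟩ := hPn'
    obtain ⟨w, hw⟩ := hPn y hy
    refine ⟨_, by rw [map_sub, hy, hερ], hw, fun w' => ?_⟩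
    rw [sub_sub, ← map_add]
    exact hyw _
  let R (m : ℕ) : Prop := ∃ y, Q y ∧ ∀ z, z ≠ x → D.s z = D.s x → r.W z (m + 1) y = 0
  have hRN : R N := by
    obtain ⟨y, hy⟩ := hQ
    exact ⟨y, hy, fun z _ _ => by rw [hN', LinearMap.zero_apply]⟩
  have hR : ∃ m, R m := ⟨N, hRN⟩
  let m := Nat.find hR
  have hmN : m ≤ N := Nat.find_min' _ hRN
  obtain ⟨y, ⟨hy, hyW, hyw⟩, hyR⟩ : R m := Nat.find_spec hR
  obtain ⟨g, hg, hgS⟩ := Submodule.exists_le_ker_of_notMem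
    (p := LinearMap.range (r.W x (n + 1) * r.ρ (D.σ.symm x))) (v := r.W x (n + 1) y) (by
      rintro ⟨w, hw⟩
      refine hyw w ?_
      rw [map_sub, sub_eq_zero]
      exact hw.symm)
  let τ : Y →ₗ[k] k := (g (r.W x (n + 1) y))⁻¹ • (g ∘ₗ r.W x (n + 1))
  have hτε : τ ∘ₗ r.ε (D.s x) = τ := by
    simp only [τ]
    rw [LinearMap.smul_comp, LinearMap.comp_assoc, ← Module.End.mul_eq_comp, W_ε]
  have hτy : τ y = 1 := inv_mul_cancel₀ hg
  have hτρ : ∀ z, τ ∘ₗ r.ρ z = 0 := by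
    intro z
    simp only [τ]
    rw [LinearMap.smul_comp, LinearMap.comp_assoc, ← Module.End.mul_eq_comp]
    by_cases hz : x = D.σ z
    · rw [← D.σ.symm_apply_eq.mpr hz]
      refine LinearMap.ext fun w => ?_
      have : g ((r.W x (n + 1) * r.ρ (D.σ.symm x)) w) = 0 := hgS ⟨w, rfl⟩
      rw [LinearMap.smul_apply, LinearMap.comp_apply, this, smul_zero, LinearMap.zero_apply]
    · rw [W_ρ _ _ _ _ hz, LinearMap.comp_zero, smul_zero]
  refine ⟨D.s x, fun z => if z = x then n + 1 else if D.s z = D.s x then m else 0, ?_,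
    hs.hasType_of_ker_le y τ hy hτε hτy hτρ ?_ ?_⟩
  · intro z
    dsimp only
    split_ifs
    exacts [hn, hmN, Nat.zero_le _]
  · intro z
    split_ifs with h1 h2
    · rw [h1]; exact hyW
    · exact hyR z h1 h2
    · rw [zero_add, W_one, ← hy, ← r.ρ_ε, Module.End.mul_apply, ← Module.End.mul_apply (r.ε _),
        r.ε_mul, if_neg h2, LinearMap.zero_apply, map_zero]
  · intro z
    split_ifs with h1 h2
    · subst h1
      intro _ w hw
      rw [LinearMap.mem_ker] at hw ⊢
      simp [τ, hw]
    · intro hm0 y₁ hy₁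
      rw [LinearMap.mem_ker] at hy₁ ⊢
      by_contra hτy₁
      obtain ⟨w, hw⟩ := hPn (r.ε (D.s x) y₁) (by rw [← Module.End.mul_apply, ε_idem])
      refine Nat.find_min hR (m := m - 1) (by omega)
        ⟨r.ε (D.s x) y₁ - r.ρ (D.σ.symm x) w, ⟨?_, hw, fun w' h => hτy₁ ?_⟩, fun z' hz' hsz' => ?_⟩
      · rw [map_sub, hερ, ← Module.End.mul_apply, ε_idem]
      · have h2 : τ (r.ε (D.s x) y₁ - r.ρ (D.σ.symm x) w - r.ρ (D.σ.symm x) w') = 0 := by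
          simp [τ, h]
        rw [map_sub, map_sub] at h2
        have h3 := fun w => LinearMap.congr_fun (hτρ (D.σ.symm x)) w
        have h4 := LinearMap.congr_fun hτε y₁
        simp only [LinearMap.comp_apply, LinearMap.zero_apply] at h3 h4
        rwa [h3, h3, sub_zero, sub_zero, h4] at h2
      · have hz : z' = z := by
          rcases D.two_le z' x z hsz' (hsz'.trans h2.symm) with h | h | h
          exacts [absurd h hz', h, absurd h.symm h1]
        obtain ⟨m', hm'⟩ := Nat.exists_eq_succ_of_ne_zero hm0
        rw [hz, Nat.sub_add_cancel (Nat.one_le_iff_ne_zero.mpr hm0), map_sub, ← h2,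
          ← Module.End.mul_apply, W_ε, hy₁, hm', ← Module.End.mul_apply,
          W_ρ _ _ _ _ (by rwa [Equiv.apply_symm_apply]), LinearMap.zero_apply, sub_zero]
    · exact fun h => absurd rfl h

theorem dualMap_zero : (0 : Y →ₗ[k] Y').dualMap = 0 :=
  LinearMap.ext fun f => LinearMap.comp_zero f

theorem dualMap_mul (f g : Module.End k Y) :
    (f.dualMap * g.dualMap : Module.End k (Module.Dual k Y)) = (g * f).dualMap := rfl

/-- The dual representation of the opposite quiver. -/
def dual (r : BranchRep D k Y) : BranchRep D.dual k (Module.Dual k Y) where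
  ε v := (r.ε v).dualMap
  ρ x := (r.ρ x).dualMap
  ε_mul u v := by
    rw [dualMap_mul, r.ε_mul]
    by_cases h : u = v
    · rw [if_pos h, if_pos h.symm, h]
    · rw [if_neg h, if_neg (Ne.symm h), dualMap_zero]
  sum_ε := by
    refine LinearMap.ext fun f => LinearMap.ext fun y => ?_
    have := congrArg f (LinearMap.congr_fun r.sum_ε y)
    simpa [LinearMap.sum_apply] using this
  ρ_ε x := by
    rw [dualMap_mul]
    exact congrArg LinearMap.dualMap (r.ε_ρ x)
  ε_ρ x := by
    rw [dualMap_mul]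
    exact congrArg LinearMap.dualMap (r.ρ_ε x)
  ρ_ρ x y h := by
    rw [dualMap_mul, r.ρ_ρ _ _ fun h' => h ((D.σ.symm_apply_eq.mpr h').symm), dualMap_zero]

theorem dual_W (r : BranchRep D k Y) (x : E) (n : ℕ) :
    r.dual.W ((D.σ ^ n) x) (n + 1) = (r.W x (n + 1)).dualMap := by
  induction n with
  | zero => rw [W_one, W_one]; rfl
  | succ n ih =>
    have h : D.dual.σ ((D.σ ^ (n + 1)) x) = (D.σ ^ n) x := by
      rw [pow_succ', Equiv.Perm.mul_apply]
      exact D.σ.symm_apply_apply _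
    rw [W_succ, h, ih, W_succ' _ _ (n + 1)]
    rfl

theorem dual_W_eq_zero {N : ℕ} (hN : ∀ x, r.W x N = 0) (x : E) : r.dual.W x N = 0 := by
  cases N with
  | zero =>
    have := hN (D.σ x)
    rw [W_zero, ← D.tgt_eq] at this
    rw [W_zero]
    exact (congrArg LinearMap.dualMap this).trans dualMap_zero
  | succ N =>
    have := r.dual_W ((D.σ ^ N).symm x) N
    rw [Equiv.apply_symm_apply] at this
    rw [this, hN, dualMap_zero]

theorem IsRepBrick.exists_hasType (hr : r.IsRepBrick) {N : ℕ} (hN : ∀ x, r.W x N = 0) :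
    ∃ v n, (∀ x, n x ≤ N) ∧ (r.HasType v n ∨ r.dual.HasType v n) := by
  have := hr.1
  by_cases hs : r.NoSocle
  · obtain ⟨v, n, hn, h⟩ := hs.exists_hasType hN
    exact ⟨v, n, hn, Or.inl h⟩
  by_cases hs' : r.dual.NoSocle
  · obtain ⟨v, n, hn, h⟩ := hs'.exists_hasType (dual_W_eq_zero hN)
    exact ⟨v, n, hn, Or.inr h⟩
  rw [NoSocle] at hs hs'
  push Not at hs hs'
  obtain ⟨y, hy, hρ, hy0⟩ := hs
  obtain ⟨l, hl, hlρ, hl0⟩ := hs'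
  replace hl : l ∘ₗ r.ε D.o = l := hl
  replace hlρ : ∀ z, l ∘ₗ r.ρ z = 0 := hlρ
  have hφ : r.IsHom r (l.smulRight y) := by
    refine ⟨fun u => LinearMap.ext fun w => ?_, fun z => LinearMap.ext fun w => ?_⟩
    · have h1 : l (r.ε u w) = if D.o = u then l w else 0 := by
        rw [← hl, LinearMap.comp_apply, ← Module.End.mul_apply, r.ε_mul]
        split_ifs <;> simp
      have h2 : r.ε u y = if D.o = u then y else 0 := by
        conv_lhs => rw [← hy]
        rw [← Module.End.mul_apply, r.ε_mul]
        by_cases h : u = D.o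
        · rw [if_pos h, if_pos h.symm, h, hy]
        · rw [if_neg h, if_neg (Ne.symm h), LinearMap.zero_apply]
      simp only [LinearMap.comp_apply, LinearMap.smulRight_apply, map_smul, h1, h2]
      split_ifs <;> simp
    · have h1 : l (r.ρ z w) = 0 := LinearMap.congr_fun (hlρ z) w
      simp [h1, hρ]
  have hφ0 : l.smulRight y ≠ 0 := by
    intro h
    refine hl0 (LinearMap.ext fun w => ?_)
    have := LinearMap.congr_fun h w
    rw [LinearMap.smulRight_apply, LinearMap.zero_apply] at this
    exact (smul_eq_zero.mp this).resolve_right hy0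
  have hly : l y ≠ 0 := by
    intro h
    refine hy0 ((hr.2 _ hφ hφ0).1 ?_)
    rw [LinearMap.smulRight_apply, h, zero_smul, map_zero]
  refine ⟨D.o, fun _ => 0, fun _ => Nat.zero_le _, Or.inl ⟨y, (l y)⁻¹ • l, fun _ => 0, hy, ?_,
    inv_mul_cancel₀ hly, fun z => ?_, fun x => ?_, fun x hx => absurd rfl hx⟩⟩
  · rw [LinearMap.smul_comp, hl]
  · rw [LinearMap.smul_comp, hlρ, smul_zero]
  · rw [zero_add, W_one, hρ]

theorem exists_isHom_of_dual [FiniteDimensional k Y] (φ : Module.Dual k Y →ₗ[k] Module.Dual k Y')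
    (hφ : r.dual.IsHom r'.dual φ) : ∃ ψ : Y' →ₗ[k] Y, r'.IsHom r ψ ∧ ψ.dualMap = φ := by
  obtain ⟨ψ, hψ⟩ : ∃ ψ : Y' →ₗ[k] Y, ∀ f y, f (ψ y) = φ f y := by
    refine ⟨(Module.evalEquiv k Y).symm.toLinearMap ∘ₗ φ.dualMap ∘ₗ Module.Dual.eval k Y',
      fun f y => ?_⟩
    simp only [LinearMap.comp_apply, LinearEquiv.coe_coe, Module.apply_evalEquiv_symm_apply]
    rfl
  refine ⟨ψ, ⟨fun v => LinearMap.ext fun y => ?_, fun x => LinearMap.ext fun y => ?_⟩,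
    LinearMap.ext fun f => LinearMap.ext fun y => hψ f y⟩
  · rw [← sub_eq_zero, ← Module.forall_dual_apply_eq_zero_iff k]
    intro f
    rw [map_sub, sub_eq_zero, LinearMap.comp_apply, LinearMap.comp_apply, hψ]
    exact (LinearMap.congr_fun (LinearMap.congr_fun (hφ.1 v) f) y).symm.trans (hψ _ _).symm
  · rw [← sub_eq_zero, ← Module.forall_dual_apply_eq_zero_iff k]
    intro f
    rw [map_sub, sub_eq_zero, LinearMap.comp_apply, LinearMap.comp_apply, hψ]
    exact (LinearMap.congr_fun (LinearMap.congr_fun (hφ.2 x) f) y).symm.trans (hψ _ _).symm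

theorem IsRepBrick.exists_bijective [Fintype E] (hr : r.IsRepBrick) (hr' : r'.IsRepBrick) {v : V}
    {n : E → ℕ} (h : r.HasType v n) (h' : r'.HasType v n) :
    ∃ φ : Y →ₗ[k] Y', r.IsHom r' φ ∧ Function.Bijective φ := by
  obtain ⟨φ, ψ, hφ, hψ, h1, h2⟩ := h.exists_homs h'
  exact ⟨φ, hφ, hr.bijective hr' hφ hψ h1 h2⟩

theorem IsRepBrick.exists_bijective_of_dual [Fintype E] [FiniteDimensional k Y]
    [FiniteDimensional k Y'] (hr : r.IsRepBrick) (hr' : r'.IsRepBrick) {v : V} {n : E → ℕ}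
    (h : r.dual.HasType v n) (h' : r'.dual.HasType v n) :
    ∃ φ : Y →ₗ[k] Y', r.IsHom r' φ ∧ Function.Bijective φ := by
  obtain ⟨φ, ψ, hφ, hψ, h1, h2⟩ := h.exists_homs h'
  obtain ⟨φ', hφ', rfl⟩ := exists_isHom_of_dual φ hφ
  obtain ⟨ψ', hψ', rfl⟩ := exists_isHom_of_dual ψ hψ
  rw [LinearMap.dualMap_comp_dualMap] at h1 h2
  refine ⟨ψ', hψ', hr.bijective hr' hψ' hφ' (fun h => h1 ?_) fun h => h2 ?_⟩
  · rw [h, dualMap_zero]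
  · rw [h, dualMap_zero]

end BranchRep

/-- An algebra generated by the vertices and the arrows of a quiver, in which the product of two
arrows vanishes unless the second is the distinguished continuation of the first. -/
structure BranchPresentation (D : BranchQuiver V E) (k : Type) [Field k] (A : Type) [Ring A]
    [Algebra k A] where
  e : V → A
  a : E → A
  e_mul : ∀ u v, e u * e v = if u = v then e u else 0
  sum_e : ∑ v, e v = 1
  e_a : ∀ x, e (D.s x) * a x = a x
  a_e : ∀ x, a x * e (D.t x) = a x
  a_a : ∀ x y, y ≠ D.σ x → a x * a y = 0
  adjoin_eq_top : Algebra.adjoin k (Set.range e ∪ Set.range a) = ⊤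

namespace BranchPresentation

variable {D : BranchQuiver V E} {k : Type} [Field k] {A : Type} [Ring A] [Algebra k A]
  (P : BranchPresentation D k A)

/-- The path of length `n` which starts with the arrow `x`. -/
def path : E → ℕ → A
  | x, 0 => P.e (D.s x)
  | x, n + 1 => P.a x * path (D.σ x) n

theorem path_zero (x : E) : P.path x 0 = P.e (D.s x) := rfl

theorem path_succ (x : E) (n : ℕ) : P.path x (n + 1) = P.a x * P.path (D.σ x) n := rfl

theorem path_one (x : E) : P.path x 1 = P.a x := by
  rw [path_succ, path_zero, ← D.tgt_eq, P.a_e]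

theorem e_mul_a (u : V) (x : E) : P.e u * P.a x = if u = D.s x then P.a x else 0 := by
  rw [← P.e_a, ← mul_assoc, P.e_mul]
  split_ifs with h
  · rw [h]
  · rw [zero_mul]

theorem a_mul_e (u : V) (x : E) : P.a x * P.e u = if u = D.t x then P.a x else 0 := by
  rw [← P.a_e, mul_assoc, P.e_mul]
  by_cases h : u = D.t x
  · rw [if_pos h, if_pos h.symm]
  · rw [if_neg h, if_neg (Ne.symm h), mul_zero]

theorem path_add (x : E) (m n : ℕ) :
    P.path x (m + n) = P.path x m * P.path ((D.σ ^ m) x) n := by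
  induction m generalizing x with
  | zero =>
    rw [zero_add, path_zero, pow_zero, Equiv.Perm.one_apply]
    cases n with
    | zero => rw [path_zero, P.e_mul, if_pos rfl]
    | succ n => rw [path_succ, ← mul_assoc, P.e_a]
  | succ m ih =>
    rw [Nat.add_right_comm, path_succ, ih, path_succ, mul_assoc, pow_succ, Equiv.Perm.mul_apply]

theorem path_eq_zero_of_le {x : E} {n m : ℕ} (h : P.path x n = 0) (hnm : n ≤ m) :
    P.path x m = 0 := by
  obtain ⟨l, rfl⟩ := Nat.exists_eq_add_of_le hnm
  rw [path_add, h, zero_mul]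

theorem finite [Finite E] {N : ℕ} (hN : ∀ x, P.path x N = 0) : Module.Finite k A := by
  let T : Set A := Set.range P.e ∪ Set.range (Function.uncurry P.path)
  have hT : T.Finite := by
    refine (Set.finite_range _).union (Set.Finite.subset
      ((Set.finite_singleton 0).union ((Set.finite_univ (α := E)).prod (Set.finite_Iio N) |>.image
        (Function.uncurry P.path))) ?_)
    rintro _ ⟨⟨x, n⟩, rfl⟩
    by_cases h : n < N
    · exact Or.inr ⟨(x, n), ⟨Set.mem_univ _, h⟩, rfl⟩
    · exact Or.inl (P.path_eq_zero_of_le (hN x) (not_lt.mp h))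
  have hpath : ∀ x n, P.path x n ∈ Submodule.span k T := fun x n =>
    Submodule.subset_span (Or.inr ⟨(x, n), rfl⟩)
  have he : ∀ v, P.e v ∈ Submodule.span k T := fun v => Submodule.subset_span (Or.inl ⟨v, rfl⟩)
  have ha : ∀ x, P.a x ∈ Submodule.span k T := fun x => P.path_one x ▸ hpath x 1
  have hgen : ∀ b ∈ Set.range P.e ∪ Set.range P.a, ∀ c ∈ T, b * c ∈ Submodule.span k T := by
    rintro _ (⟨u, rfl⟩ | ⟨z, rfl⟩) _ (⟨v, rfl⟩ | ⟨⟨x, n⟩, rfl⟩)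
    · rw [P.e_mul]
      split_ifs
      exacts [he _, zero_mem _]
    · cases n with
      | zero =>
        rw [Function.uncurry_apply_pair, path_zero, P.e_mul]
        split_ifs
        exacts [he _, zero_mem _]
      | succ n =>
        rw [Function.uncurry_apply_pair, path_succ, ← mul_assoc, P.e_mul_a]
        split_ifs
        · exact hpath x (n + 1)
        · rw [zero_mul]
          exact zero_mem _
    · rw [P.a_mul_e]
      split_ifs
      exacts [ha _, zero_mem _]
    · cases n with
      | zero =>
        rw [Function.uncurry_apply_pair, path_zero, P.a_mul_e]
        split_ifs
        exacts [ha _, zero_mem _]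
      | succ n =>
        rw [Function.uncurry_apply_pair]
        by_cases hx : x = D.σ z
        · rw [hx]
          exact hpath z (n + 2)
        · rw [path_succ, ← mul_assoc, P.a_a _ _ hx, zero_mul]
          exact zero_mem _
  have hmul : ∀ b : A, ∀ c ∈ Submodule.span k T, b * c ∈ Submodule.span k T := by
    intro b
    have hb : b ∈ Algebra.adjoin k (Set.range P.e ∪ Set.range P.a) := by
      rw [P.adjoin_eq_top]
      exact Algebra.mem_top
    induction hb using Algebra.adjoin_induction with
    | mem b hb =>
      intro c hc
      have : Submodule.span k T ≤ (Submodule.span k T).comap (LinearMap.mulLeft k b) :=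
        Submodule.span_le.mpr fun c hc => hgen b hb c hc
      exact this hc
    | algebraMap r =>
      intro c hc
      rw [← Algebra.smul_def]
      exact Submodule.smul_mem _ _ hc
    | add b b' _ _ h h' =>
      intro c hc
      rw [add_mul]
      exact add_mem (h c hc) (h' c hc)
    | mul b b' _ _ h h' =>
      intro c hc
      rw [mul_assoc]
      exact h _ (h' c hc)
  refine ⟨⟨hT.toFinset, ?_⟩⟩
  rw [Set.Finite.coe_toFinset, eq_top_iff]
  intro b _
  rw [← mul_one b, ← P.sum_e]
  exact hmul b _ (Submodule.sum_mem _ fun v _ => he v)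

section Rep

variable (Y : Type) [AddCommGroup Y] [Module k Y] [Module Aᵐᵒᵖ Y] [IsScalarTower k Aᵐᵒᵖ Y]

theorem lsmul_op_mul (b c : A) : Algebra.lsmul k k Y (op b) * Algebra.lsmul k k Y (op c) =
    Algebra.lsmul k k Y (op (c * b)) := by
  rw [← map_mul, op_mul]

/-- The representation underlying a right module. -/
def rep : BranchRep D k Y where
  ε v := Algebra.lsmul k k Y (op (P.e v))
  ρ x := Algebra.lsmul k k Y (op (P.a x))
  ε_mul u v := by
    rw [lsmul_op_mul, P.e_mul]
    by_cases h : u = v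
    · rw [if_pos h, if_pos h.symm, h]
    · rw [if_neg h, if_neg (Ne.symm h), MulOpposite.op_zero, map_zero]
  sum_ε := by
    rw [← map_sum, ← Finset.op_sum, P.sum_e, op_one, map_one]
  ρ_ε x := by rw [lsmul_op_mul, P.e_a]
  ε_ρ x := by rw [lsmul_op_mul, P.a_e]
  ρ_ρ x y h := by rw [lsmul_op_mul, P.a_a _ _ h, MulOpposite.op_zero, map_zero]

theorem rep_W (x : E) (n : ℕ) : (P.rep Y).W x n = Algebra.lsmul k k Y (op (P.path x n)) := by
  induction n generalizing x with
  | zero => rfl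
  | succ n ih =>
    rw [BranchRep.W_succ, ih, path_succ]
    exact lsmul_op_mul Y _ _

variable {Y} {Y' : Type} [AddCommGroup Y'] [Module k Y'] [Module Aᵐᵒᵖ Y'] [IsScalarTower k Aᵐᵒᵖ Y']

theorem exists_linearMap {φ : Y →ₗ[k] Y'} (hφ : (P.rep Y).IsHom (P.rep Y') φ) :
    ∃ Φ : Y →ₗ[Aᵐᵒᵖ] Y', ∀ y, Φ y = φ y := by
  have h : ∀ (b : A) (y : Y), φ (op b • y) = op b • φ y := by
    intro b
    have hb : b ∈ Algebra.adjoin k (Set.range P.e ∪ Set.range P.a) := by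
      rw [P.adjoin_eq_top]
      exact Algebra.mem_top
    induction hb using Algebra.adjoin_induction with
    | mem b hb =>
      intro y
      obtain ⟨v, rfl⟩ | ⟨x, rfl⟩ := hb
      exacts [LinearMap.congr_fun (hφ.1 v) y, LinearMap.congr_fun (hφ.2 x) y]
    | algebraMap c =>
      intro y
      rw [← MulOpposite.algebraMap_apply, algebraMap_smul, algebraMap_smul, map_smul]
    | add b c _ _ hb hc =>
      intro y
      rw [MulOpposite.op_add, add_smul, add_smul, map_add, hb, hc]
    | mul b c _ _ hb hc =>
      intro y
      rw [op_mul, mul_smul, mul_smul, hc, hb]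
  exact ⟨{ toFun := φ, map_add' := map_add φ, map_smul' := fun b y => h b.unop y }, fun _ => rfl⟩

theorem isRepBrick (hY : IsBrick Aᵐᵒᵖ Y) : (P.rep Y).IsRepBrick := by
  refine ⟨hY.1, fun φ hφ h0 => ?_⟩
  obtain ⟨Φ, hΦ⟩ := P.exists_linearMap hφ
  have hfun : ⇑Φ = φ := funext hΦ
  rw [← hfun]
  refine hY.2 Φ fun h => h0 (LinearMap.ext fun y => ?_)
  rw [← hΦ, h, LinearMap.zero_apply, LinearMap.zero_apply]

end Rep

theorem tauTiltingFinite [Fintype E] {N : ℕ} (hN : ∀ x, P.path x N = 0) :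
    TauTiltingFinite k A := by
  classical
  have := P.finite hN
  have : Module.Finite k Aᵐᵒᵖ := Module.Finite.equiv (opLinearEquiv k)
  let Good (i : Bool × V × (E → Fin (N + 1))) (Y : ModuleCat.{0} Aᵐᵒᵖ) : Prop :=
    ∃ (_ : Module k Y) (_ : IsScalarTower k Aᵐᵒᵖ Y), Module.Finite Aᵐᵒᵖ Y ∧ IsBrick Aᵐᵒᵖ Y ∧
      cond i.1 ((P.rep Y).HasType i.2.1 fun x => i.2.2 x)
        ((P.rep Y).dual.HasType i.2.1 fun x => i.2.2 x)
  let X (i : Bool × V × (E → Fin (N + 1))) : ModuleCat.{0} Aᵐᵒᵖ :=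
    if h : ∃ Y, Good i Y then h.choose else ModuleCat.of Aᵐᵒᵖ PUnit
  refine tauTiltingFinite_of_finite_bricks k A X fun Y _ _ _ hY => ?_
  let mod : Module k Y := Module.compHom Y (algebraMap k Aᵐᵒᵖ)
  have tower : IsScalarTower k Aᵐᵒᵖ Y := Module.compHom_isScalarTower k Y
  obtain ⟨v, n, hn, htype⟩ := (P.isRepBrick hY).exists_hasType (N := N) fun x => by
    rw [P.rep_W, hN, MulOpposite.op_zero, map_zero]
  let m (x : E) : Fin (N + 1) := ⟨n x, Nat.lt_succ_of_le (hn x)⟩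
  obtain ⟨b, hb⟩ : ∃ b, Good (b, v, m) (ModuleCat.of Aᵐᵒᵖ Y) := by
    rcases htype with h | h
    · exact ⟨true, mod, tower, ‹_›, hY, h⟩
    · exact ⟨false, mod, tower, ‹_›, hY, h⟩
  have hX : Good (b, v, m) (X (b, v, m)) := by
    have h : ∃ Y, Good (b, v, m) Y := ⟨_, hb⟩
    simp only [X]
    rw [dif_pos h]
    exact h.choose_spec
  refine ⟨(b, v, m), ?_⟩
  generalize X (b, v, m) = Z at hX
  obtain ⟨_, _, _, hY, hYt⟩ := hb
  obtain ⟨_, _, _, hZ, hZt⟩ := hX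
  have : FiniteDimensional k (ModuleCat.of Aᵐᵒᵖ Y) := Module.Finite.trans Aᵐᵒᵖ _
  have : FiniteDimensional k Z := Module.Finite.trans Aᵐᵒᵖ _
  obtain ⟨φ, hφ, hbij⟩ : ∃ φ : ModuleCat.of Aᵐᵒᵖ Y →ₗ[k] Z,
      (P.rep (ModuleCat.of Aᵐᵒᵖ Y)).IsHom (P.rep Z) φ ∧ Function.Bijective φ := by
    cases b with
    | true => exact (P.isRepBrick hY).exists_bijective (P.isRepBrick hZ) hYt hZt
    | false => exact (P.isRepBrick hY).exists_bijective_of_dual (P.isRepBrick hZ) hYt hZt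
  obtain ⟨Φ, hΦ⟩ := P.exists_linearMap hφ
  exact ⟨LinearEquiv.ofBijective Φ ((funext hΦ : ⇑Φ = φ) ▸ hbij)⟩

end BranchPresentation

end Branch

/-! ### The algebra `A(p,q)` -/

section TwoCycleBranch

/-- The arrow of the first cycle with index `i`. -/
def cycL (p q : ℕ) (i : ZMod p) : CycE p q := Sum.inl i

/-- The arrow of the second cycle with index `j`. -/
def cycR (p q : ℕ) (j : ZMod q) : CycE p q := Sum.inr j

/-- The common vertex of the two cycles. -/
def cycBase (p q : ℕ) : CycV p q := none

section Quiver

variable {p q : ℕ}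

theorem cycL_or_cycR (x : CycE p q) : (∃ i, x = cycL p q i) ∨ ∃ j, x = cycR p q j := by
  rcases x with i | j
  exacts [Or.inl ⟨i, rfl⟩, Or.inr ⟨j, rfl⟩]

theorem cycL_ne_cycR {i : ZMod p} {j : ZMod q} : cycL p q i ≠ cycR p q j :=
  Sum.inl_ne_inr

theorem cycVL_eq_cycBase {i : ZMod p} : cycVL p q i = cycBase p q ↔ i = 0 := by
  by_cases h : i = 0
  · exact iff_of_true (dif_pos h) h
  · exact iff_of_false (fun h' => Option.some_ne_none _ ((dif_neg h).symm.trans h')) h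

theorem cycVR_eq_cycBase {j : ZMod q} : cycVR p q j = cycBase p q ↔ j = 0 := by
  by_cases h : j = 0
  · exact iff_of_true (dif_pos h) h
  · exact iff_of_false (fun h' => Option.some_ne_none _ ((dif_neg h).symm.trans h')) h

theorem eq_of_cycSrc_eq_cycBase {x : CycE p q} (h : cycSrc p q x = cycBase p q) :
    x = cycL p q 0 ∨ x = cycR p q 0 := by
  rcases cycL_or_cycR x with ⟨i, rfl⟩ | ⟨j, rfl⟩
  · exact Or.inl (congrArg _ (cycVL_eq_cycBase.mp h))
  · exact Or.inr (congrArg _ (cycVR_eq_cycBase.mp h))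

theorem eq_of_cycSrc_eq {x y : CycE p q} (h : cycSrc p q x = cycSrc p q y)
    (hx : cycSrc p q x ≠ cycBase p q) : x = y := by
  have hy := h ▸ hx
  have hL {i : ZMod p} (hi : cycVL p q i ≠ cycBase p q) :
      cycVL p q i = some (Sum.inl ⟨i, mt cycVL_eq_cycBase.mpr hi⟩) :=
    dif_neg (mt cycVL_eq_cycBase.mpr hi)
  have hR {j : ZMod q} (hj : cycVR p q j ≠ cycBase p q) :
      cycVR p q j = some (Sum.inr ⟨j, mt cycVR_eq_cycBase.mpr hj⟩) :=
    dif_neg (mt cycVR_eq_cycBase.mpr hj)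
  rcases cycL_or_cycR x with ⟨i, rfl⟩ | ⟨i, rfl⟩ <;>
    rcases cycL_or_cycR y with ⟨j, rfl⟩ | ⟨j, rfl⟩
  · exact congrArg _ (Subtype.ext_iff.mp (Sum.inl_injective (Option.some_injective _
      ((hL hx).symm.trans (h.trans (hL hy))))))
  · exact absurd (Option.some_injective _ ((hL hx).symm.trans (h.trans (hR hy)))) Sum.inl_ne_inr
  · exact absurd (Option.some_injective _ ((hR hx).symm.trans (h.trans (hL hy)))) Sum.inr_ne_inl
  · exact congrArg _ (Subtype.ext_iff.mp (Sum.inr_injective (Option.some_injective _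
      ((hR hx).symm.trans (h.trans (hR hy))))))

end Quiver

/-- The continuation of arrows of `Δ(p,q)` which changes the cycle at the common vertex. -/
def cycNext (p q : ℕ) : Equiv.Perm (CycE p q) := show Equiv.Perm (ZMod p ⊕ ZMod q) from
  { toFun
      | Sum.inl i => if i + 1 = 0 then Sum.inr 0 else Sum.inl (i + 1)
      | Sum.inr j => if j + 1 = 0 then Sum.inl 0 else Sum.inr (j + 1)
    invFun
      | Sum.inl i => if i = 0 then Sum.inr (-1) else Sum.inl (i - 1)
      | Sum.inr j => if j = 0 then Sum.inl (-1) else Sum.inr (j - 1)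
    left_inv := by
      rintro (i | j)
      · by_cases h : i + 1 = 0
        · simp [eq_neg_of_add_eq_zero_left h]
        · simp [h]
      · by_cases h : j + 1 = 0
        · simp [eq_neg_of_add_eq_zero_left h]
        · simp [h]
    right_inv := by
      rintro (i | j)
      · by_cases h : i = 0 <;> simp [h]
      · by_cases h : j = 0 <;> simp [h] }

theorem cycNext_cycL (p q : ℕ) (i : ZMod p) : cycNext p q (cycL p q i) =
    if i + 1 = 0 then cycR p q 0 else cycL p q (i + 1) := rfl

theorem cycNext_cycR (p q : ℕ) (j : ZMod q) : cycNext p q (cycR p q j) =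
    if j + 1 = 0 then cycL p q 0 else cycR p q (j + 1) := rfl

theorem cycNext_symm_cycL_zero (p q : ℕ) : (cycNext p q).symm (cycL p q 0) = cycR p q (-1) :=
  if_pos rfl

theorem cycNext_symm_cycR_zero (p q : ℕ) : (cycNext p q).symm (cycR p q 0) = cycL p q (-1) :=
  if_pos rfl

/-- The quiver `Δ(p,q)` with the continuation of arrows `cycNext p q`. -/
def cycQuiver (p q : ℕ) : BranchQuiver (CycV p q) (CycE p q) where
  s := cycSrc p q
  t := cycTgt p q
  σ := cycNext p q
  o := cycBase p q
  tgt_eq x := by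
    rcases cycL_or_cycR x with ⟨i, rfl⟩ | ⟨j, rfl⟩
    · rw [cycNext_cycL]
      split_ifs with h
      · exact (cycVL_eq_cycBase.mpr h).trans (cycVR_eq_cycBase.mpr rfl).symm
      · rfl
    · rw [cycNext_cycR]
      split_ifs with h
      · exact (cycVR_eq_cycBase.mpr h).trans (cycVL_eq_cycBase.mpr rfl).symm
      · rfl
  eq_of_src _ _ h hx := eq_of_cycSrc_eq h hx
  two_le x y z h h' := by
    by_cases hx : cycSrc p q x = cycBase p q
    · rcases eq_of_cycSrc_eq_cycBase hx with h1 | h1 <;>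
        rcases eq_of_cycSrc_eq_cycBase (h ▸ hx) with h2 | h2 <;>
        rcases eq_of_cycSrc_eq_cycBase (h' ▸ hx) with h3 | h3 <;>
        simp only [h1, h2, h3, true_or, or_true]
    · exact Or.inl (eq_of_cycSrc_eq h hx)

theorem cycNext_pow_cycL (p q : ℕ) {n : ℕ} (hn : n < p) :
    (cycNext p q ^ n) (cycL p q 0) = cycL p q n := by
  induction n with
  | zero => rw [Nat.cast_zero]; rfl
  | succ n ih =>
    have h : (n : ZMod p) + 1 ≠ 0 := by
      intro h
      rw [← Nat.cast_succ, ZMod.natCast_eq_zero_iff] at h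
      exact absurd (Nat.le_of_dvd n.succ_pos h) (not_le.mpr hn)
    rw [pow_succ', Equiv.Perm.mul_apply, ih (by omega), cycNext_cycL, if_neg h, Nat.cast_succ]

theorem cycNext_pow_cycR (p q : ℕ) {n : ℕ} (hn : n < q) :
    (cycNext p q ^ n) (cycR p q 0) = cycR p q n := by
  induction n with
  | zero => rw [Nat.cast_zero]; rfl
  | succ n ih =>
    have h : (n : ZMod q) + 1 ≠ 0 := by
      intro h
      rw [← Nat.cast_succ, ZMod.natCast_eq_zero_iff] at h
      exact absurd (Nat.le_of_dvd n.succ_pos h) (not_le.mpr hn)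
    rw [pow_succ', Equiv.Perm.mul_apply, ih (by omega), cycNext_cycR, if_neg h, Nat.cast_succ]

theorem aw_zero_eq (p q : ℕ) : aw p q 0 p = (List.range p).map fun i => (cycNext p q ^ i) (cycL p q
    0) := by
  refine List.map_congr_left fun i hi => ?_
  rw [cycNext_pow_cycL p q (List.mem_range.mp hi), zero_add]
  rfl

theorem bw_zero_eq (p q : ℕ) : bw p q 0 q = (List.range q).map fun i => (cycNext p q ^ i) (cycR p q
    0) := by
  refine List.map_congr_left fun i hi => ?_
  rw [cycNext_pow_cycR p q (List.mem_range.mp hi), zero_add]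
  rfl

theorem aw_one (p q i : ℕ) : aw p q i 1 = [cycL p q i] := rfl

theorem bw_one (p q j : ℕ) : bw p q j 1 = [cycR p q j] := rfl


theorem cycNext_pow_cycL_self (p q : ℕ) [NeZero p] : (cycNext p q ^ p) (cycL p q 0) = cycR p q 0 := by
  obtain ⟨n, hn⟩ := Nat.exists_eq_succ_of_ne_zero (NeZero.ne p)
  have h : (n : ZMod p) + 1 = 0 := by
    rw [← Nat.cast_succ, ← hn, ZMod.natCast_self]
  conv_lhs => rw [show cycNext p q ^ p = cycNext p q ^ (n + 1) from congrArg _ hn]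
  rw [pow_succ', Equiv.Perm.mul_apply, cycNext_pow_cycL p q (by omega), cycNext_cycL, if_pos h]

theorem cycNext_pow_cycR_self (p q : ℕ) [NeZero q] : (cycNext p q ^ q) (cycR p q 0) = cycL p q 0 := by
  obtain ⟨n, hn⟩ := Nat.exists_eq_succ_of_ne_zero (NeZero.ne q)
  have h : (n : ZMod q) + 1 = 0 := by
    rw [← Nat.cast_succ, ← hn, ZMod.natCast_self]
  conv_lhs => rw [show cycNext p q ^ q = cycNext p q ^ (n + 1) from congrArg _ hn]
  rw [pow_succ', Equiv.Perm.mul_apply, cycNext_pow_cycR p q (by omega), cycNext_cycR, if_pos h]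

variable (p q : ℕ) [NeZero p] [NeZero q]

theorem exists_cycNext_pow_eq (x : CycE p q) :
    ∃ n ≤ p + q, (cycNext p q ^ n) x = cycL p q 0 := by
  have hpq : (cycNext p q ^ (q + p)) (cycL p q 0) = cycL p q 0 := by
    rw [pow_add, Equiv.Perm.mul_apply, cycNext_pow_cycL_self, cycNext_pow_cycR_self]
  obtain ⟨m, hm, rfl⟩ : ∃ m ≤ q + p, (cycNext p q ^ m) (cycL p q 0) = x := by
    rcases cycL_or_cycR x with ⟨i, rfl⟩ | ⟨j, rfl⟩
    · refine ⟨i.val, by have := i.val_lt; omega, ?_⟩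
      rw [cycNext_pow_cycL p q i.val_lt, ZMod.natCast_zmod_val]
    · refine ⟨j.val + p, by have := j.val_lt; omega, ?_⟩
      rw [pow_add, Equiv.Perm.mul_apply, cycNext_pow_cycL_self, cycNext_pow_cycR p q j.val_lt,
        ZMod.natCast_zmod_val]
  refine ⟨q + p - m, by omega, ?_⟩
  rw [← Equiv.Perm.mul_apply, ← pow_add, Nat.sub_add_cancel hm, hpq]

variable (k : Type) [Field k]

theorem arrWord_append {V E : Type} (l l' : List E) :
    (arrWord k (l ++ l') : FreeAlgebra k (V ⊕ E)) = arrWord k l * arrWord k l' := by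
  rw [arrWord, List.map_append, List.prod_append]
  rfl

theorem arrWord_singleton {V E : Type} (x : E) :
    (arrWord k [x] : FreeAlgebra k (V ⊕ E)) = FreeAlgebra.ι k (Sum.inr x) := by
  rw [arrWord, List.map_singleton, List.prod_singleton]

/-- The canonical map from the free algebra to a bound quiver algebra. -/
def BoundQuiverAlg.mk {V E : Type} [Fintype V] [DecidableEq V] (s t : E → V)
    (extra : FreeAlgebra k (V ⊕ E) → FreeAlgebra k (V ⊕ E) → Prop) :
    FreeAlgebra k (V ⊕ E) →ₐ[k] BoundQuiverAlg k s t extra :=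
  RingQuot.mkAlgHom k (quivRel k s t extra)

namespace BoundQuiverAlg

variable {k} {V E : Type} [Fintype V] [DecidableEq V] {s t : E → V}
  {extra : FreeAlgebra k (V ⊕ E) → FreeAlgebra k (V ⊕ E) → Prop}

theorem mk_surjective : Function.Surjective (mk k s t extra) :=
  RingQuot.mkAlgHom_surjective k _

theorem mk_rel {x y : FreeAlgebra k (V ⊕ E)} (h : quivRel k s t extra x y) :
    mk k s t extra x = mk k s t extra y :=
  RingQuot.mkAlgHom_rel k h

theorem mk_extra {x y : FreeAlgebra k (V ⊕ E)} (h : extra x y) :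
    mk k s t extra x = mk k s t extra y :=
  mk_rel (Or.inr (Or.inr (Or.inr (Or.inr h))))

theorem e_mul_e (u v : V) : mk k s t extra (FreeAlgebra.ι k (Sum.inl u)) *
    mk k s t extra (FreeAlgebra.ι k (Sum.inl v)) =
    if u = v then mk k s t extra (FreeAlgebra.ι k (Sum.inl u)) else 0 := by
  rw [← map_mul, mk_rel (Or.inl ⟨u, v, rfl, rfl⟩)]
  split_ifs
  exacts [rfl, map_zero _]

theorem sum_e : ∑ v, mk k s t extra (FreeAlgebra.ι k (Sum.inl v)) = 1 := by
  rw [← map_sum, mk_rel (Or.inr (Or.inl ⟨rfl, rfl⟩)), map_one]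

theorem e_mul_a (x : E) : mk k s t extra (FreeAlgebra.ι k (Sum.inl (s x))) *
    mk k s t extra (FreeAlgebra.ι k (Sum.inr x)) = mk k s t extra (FreeAlgebra.ι k (Sum.inr x)) := by
  rw [← map_mul, mk_rel (Or.inr (Or.inr (Or.inl ⟨x, rfl, rfl⟩)))]

theorem a_mul_e (x : E) : mk k s t extra (FreeAlgebra.ι k (Sum.inr x)) *
    mk k s t extra (FreeAlgebra.ι k (Sum.inl (t x))) = mk k s t extra (FreeAlgebra.ι k (Sum.inr x)) := by
  rw [← map_mul, mk_rel (Or.inr (Or.inr (Or.inr (Or.inl ⟨x, rfl, rfl⟩))))]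

theorem a_mul_a {x y : E} (h : t x ≠ s y) : mk k s t extra (FreeAlgebra.ι k (Sum.inr x)) *
    mk k s t extra (FreeAlgebra.ι k (Sum.inr y)) = 0 := by
  rw [← a_mul_e, ← e_mul_a y, mul_assoc, ← mul_assoc (mk k s t extra (.ι k (Sum.inl (t x)))),
    e_mul_e, if_neg h, zero_mul, mul_zero]

theorem adjoin_eq_top :
    Algebra.adjoin k (Set.range (fun v => mk k s t extra (FreeAlgebra.ι k (Sum.inl v))) ∪
      Set.range fun x => mk k s t extra (FreeAlgebra.ι k (Sum.inr x))) = ⊤ := by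
  have h := congrArg (Subalgebra.map (mk k s t extra)) (FreeAlgebra.adjoin_range_ι k (V ⊕ E))
  rw [AlgHom.map_adjoin, Algebra.map_top, (AlgHom.range_eq_top _).mpr mk_surjective] at h
  rw [← h, ← Set.range_comp]
  congr 1
  ext b
  simp only [Set.mem_union, Set.mem_range, Sum.exists, Function.comp_apply]

end BoundQuiverAlg

/-- The presentation of `A(p,q)` by vertices and arrows. -/
def cycPresentation : BranchPresentation (cycQuiver p q) k
    (BoundQuiverAlg k (cycSrc p q) (cycTgt p q) (ARelExtra k p q)) where
  e v := BoundQuiverAlg.mk k _ _ _ (FreeAlgebra.ι k (Sum.inl v))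
  a x := BoundQuiverAlg.mk k _ _ _ (FreeAlgebra.ι k (Sum.inr x))
  e_mul := BoundQuiverAlg.e_mul_e
  sum_e := BoundQuiverAlg.sum_e
  e_a := BoundQuiverAlg.e_mul_a
  a_e := BoundQuiverAlg.a_mul_e
  adjoin_eq_top := BoundQuiverAlg.adjoin_eq_top
  a_a x y hy := by
    by_cases hxy : cycTgt p q x = cycSrc p q y
    swap
    · exact BoundQuiverAlg.a_mul_a hxy
    have hσ : cycTgt p q x = cycSrc p q (cycNext p q x) := (cycQuiver p q).tgt_eq x
    have hnone : cycSrc p q y = cycBase p q := by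
      by_contra h
      exact hy (eq_of_cycSrc_eq (hxy.symm.trans hσ) h)
    have hx : x = (cycNext p q).symm (cycNext p q x) := (Equiv.symm_apply_apply _ _).symm
    replace hy : y ≠ cycNext p q x := hy
    rcases eq_of_cycSrc_eq_cycBase hnone with rfl | rfl <;>
      rcases eq_of_cycSrc_eq_cycBase (hσ.symm.trans (hxy.trans hnone)) with h | h <;>
      rw [h] at hx hy
    · exact absurd rfl hy
    · have hx' : x = cycL p q ((p - 1 : ℕ) : ZMod p) := by
        rw [Nat.cast_pred (NeZero.pos p), ZMod.natCast_self, zero_sub, hx,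
          cycNext_symm_cycR_zero]
      have := BoundQuiverAlg.mk_extra (s := cycSrc p q) (t := cycTgt p q)
        (extra := ARelExtra k p q) (Or.inr (Or.inl ⟨rfl, rfl⟩))
      rw [arrWord_append, map_mul, map_zero, aw_one, aw_one, ← hx', Nat.cast_zero,
        arrWord_singleton, arrWord_singleton] at this
      exact this
    · have hx' : x = cycR p q ((q - 1 : ℕ) : ZMod q) := by
        rw [Nat.cast_pred (NeZero.pos q), ZMod.natCast_self, zero_sub, hx,
          cycNext_symm_cycL_zero]
      have := BoundQuiverAlg.mk_extra (s := cycSrc p q) (t := cycTgt p q)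
        (extra := ARelExtra k p q) (Or.inr (Or.inr (Or.inl ⟨rfl, rfl⟩)))
      rw [arrWord_append, map_mul, map_zero, bw_one, bw_one, ← hx', Nat.cast_zero,
        arrWord_singleton, arrWord_singleton] at this
      exact this
    · exact absurd rfl hy

theorem cycPresentation_path (x : CycE p q) (n : ℕ) : (cycPresentation p q k).path x (n + 1) =
    BoundQuiverAlg.mk k _ _ _
      (arrWord k ((List.range (n + 1)).map fun i => (cycNext p q ^ i) x)) := by
  induction n with
  | zero =>
    rw [BranchPresentation.path_one]
    exact congrArg _ (arrWord_singleton k x).symm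
  | succ n ih =>
    rw [BranchPresentation.path_add, ih, BranchPresentation.path_one, List.range_succ (n := n + 1),
      List.map_append, arrWord_append, map_mul, List.map_singleton, arrWord_singleton]
    rfl

theorem cycPresentation_path_eq_zero (x : CycE p q) :
    (cycPresentation p q k).path x (p + q + (p + q + 1)) = 0 := by
  obtain ⟨m, hm⟩ := Nat.exists_eq_succ_of_ne_zero (NeZero.ne p)
  obtain ⟨l, hl⟩ := Nat.exists_eq_succ_of_ne_zero (NeZero.ne q)
  have ha : (cycPresentation p q k).path (cycL p q 0) p =
      BoundQuiverAlg.mk k _ _ _ (arrWord k (aw p q 0 p)) := by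
    rw [aw_zero_eq]
    convert cycPresentation_path p q k (cycL p q 0) m
  have hb : (cycPresentation p q k).path (cycR p q 0) q =
      BoundQuiverAlg.mk k _ _ _ (arrWord k (bw p q 0 q)) := by
    rw [bw_zero_eq]
    convert cycPresentation_path p q k (cycR p q 0) l
  have hab : (cycPresentation p q k).path (cycL p q 0) p * (cycPresentation p q k).path (cycR p q
      0) q =
      (cycPresentation p q k).path (cycR p q 0) q * (cycPresentation p q k).path (cycL p q 0) p := by
    rw [ha, hb, ← map_mul, ← map_mul, ← arrWord_append, ← arrWord_append]
    exact BoundQuiverAlg.mk_extra (Or.inl ⟨rfl, rfl⟩)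
  have haa : (cycPresentation p q k).path (cycL p q 0) p * (cycPresentation p q k).a (cycL p q 0) =
      0 := by
    have h : (cycNext p q) ((cycNext p q ^ m) (cycL p q 0)) = cycR p q 0 := by
      rw [← Equiv.Perm.mul_apply, ← pow_succ', ← Nat.succ_eq_add_one, ← hm, cycNext_pow_cycL_self]
    have h' : (cycPresentation p q k).path (cycL p q 0) p =
        (cycPresentation p q k).path (cycL p q 0) m *
          (cycPresentation p q k).a ((cycNext p q ^ m) (cycL p q 0)) := by
      have := (cycPresentation p q k).path_add (cycL p q 0) m 1
      rw [BranchPresentation.path_one, ← Nat.succ_eq_add_one, ← hm] at this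
      exact this
    rw [h', mul_assoc, (cycPresentation p q k).a_a _ _ (h.symm ▸ cycL_ne_cycR), mul_zero]
  have h0 : (cycPresentation p q k).path (cycL p q 0) (p + q + 1) = 0 := by
    rw [BranchPresentation.path_add, BranchPresentation.path_add]
    change _ * (cycPresentation p q k).path ((cycNext p q ^ p) (cycL p q 0)) q *
      (cycPresentation p q k).path ((cycNext p q ^ (p + q)) (cycL p q 0)) 1 = 0
    rw [add_comm p q, pow_add, Equiv.Perm.mul_apply, cycNext_pow_cycL_self, cycNext_pow_cycR_self,
        hab,
      BranchPresentation.path_one, mul_assoc, haa, mul_zero]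
  obtain ⟨n, hn, hx⟩ := exists_cycNext_pow_eq p q x
  refine (cycPresentation p q k).path_eq_zero_of_le (n := n + (p + q + 1)) ?_ (by omega)
  rw [BranchPresentation.path_add]
  change _ * (cycPresentation p q k).path ((cycNext p q ^ n) x) _ = 0
  rw [hx, h0, mul_zero]

end TwoCycleBranch

/-- For all `1 ≤ p ≤ q`, the algebra `A(p,q)` is τ-tilting finite. -/
theorem statement13 (k : Type) [Field k] [IsAlgClosed k]
    (p q : ℕ) (hp : 1 ≤ p) (hpq : p ≤ q) :
    TauTiltingFinite k (AAlg k p q hp (le_trans hp hpq)) := by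
  have : NeZero p := ⟨by omega⟩
  have : NeZero q := ⟨by omega⟩
  have : Finite (CycE p q) := inferInstanceAs (Finite (ZMod p ⊕ ZMod q))
  let _ : Fintype (CycE p q) := Fintype.ofFinite _
  exact (cycPresentation p q k).tauTiltingFinite (cycPresentation_path_eq_zero p q k)

end
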